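/- arXiv:2501.11461 — 5 statements merged into one kernel-verified Lean document; each statement's English description precedes it below -/
import Mathlib

section
/- Let m ≤ n be natural numbers with m ≥ 1. If the rational number binom(n−1/2, m) = (2n−1)!! / ((2(n−m)−1)!! · 2^m · m!) is (4m+1)-smooth, then m ≤ 142 or n ≤ 3m − 1. -/
open Nat

open Chebyshev ArithmeticFunction in
lemma log_factorial_eq_sum_vonMangoldt (n : ℕ) :
    Real.log (n ! : ℝ) = ∑ d ∈ Finset.Ioc 0 n, vonMangoldt d * ((n / d : ℕ) : ℝ) := by
  rw [← sum_Ioc_mul_zeta_eq_sum, vonMangoldt_mul_zeta]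
  induction n with
  | zero => simp
  | succ k ih =>
    rw [Finset.sum_Ioc_succ_top (Nat.zero_le _), ← ih, Nat.factorial_succ, Nat.cast_mul,
      Real.log_mul (by positivity) (by positivity), log_apply]
    ring

open ArithmeticFunction in
lemma log_factorial_div_eq_sum_vonMangoldt (n k : ℕ) :
    Real.log ((n / k)! : ℝ) =
      ∑ d ∈ Finset.Ioc 0 n, vonMangoldt d * ((n / d / k : ℕ) : ℝ) := by
  rw [log_factorial_eq_sum_vonMangoldt]
  have hsub : Finset.Ioc 0 (n / k) ⊆ Finset.Ioc 0 n :=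
    Finset.Ioc_subset_Ioc_right (Nat.div_le_self _ _)
  rw [← Finset.sum_subset hsub]
  · refine Finset.sum_congr rfl fun d _ => ?_
    rw [Nat.div_div_eq_div_mul, Nat.div_div_eq_div_mul, mul_comm k d]
  · intro d hd hd'
    simp only [Finset.mem_Ioc, not_and, not_le] at hd hd'
    have h1 := hd' hd.1
    have : n / d / k = 0 := by
      rw [Nat.div_div_eq_div_mul, mul_comm, ← Nat.div_div_eq_div_mul]
      exact Nat.div_eq_of_lt h1
    simp [this]

/-- The integer combination `∑ e ⌊y / k⌋` over the pairs `(k, e)` of a list. -/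
def floorComb (l : List (ℕ × ℤ)) (y : ℕ) : ℤ :=
  (l.map fun q => q.2 * ((y / q.1 : ℕ) : ℤ)).sum

/-- The combination `∑ e log ⌊n / k⌋!` over the pairs `(k, e)` of a list. -/
noncomputable def logFactorialComb (l : List (ℕ × ℤ)) (n : ℕ) : ℝ :=
  (l.map fun q => (q.2 : ℝ) * Real.log ((n / q.1)! : ℝ)).sum

open ArithmeticFunction in
lemma logFactorialComb_eq_sum (l : List (ℕ × ℤ)) (n : ℕ) :
    logFactorialComb l n =
      ∑ d ∈ Finset.Ioc 0 n, vonMangoldt d * (floorComb l (n / d) : ℝ) := by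
  induction l with
  | nil => simp [logFactorialComb, floorComb]
  | cons q l ih =>
    simp only [logFactorialComb, floorComb, List.map_cons, List.sum_cons] at ih ⊢
    rw [ih, log_factorial_div_eq_sum_vonMangoldt, Finset.mul_sum, ← Finset.sum_add_distrib]
    refine Finset.sum_congr rfl fun d _ => ?_
    rw [Int.cast_add, Int.cast_mul, Int.cast_natCast]
    ring

lemma floorComb_eq_mod (l : List (ℕ × ℤ)) (L y : ℕ) (hl : ∀ q ∈ l, 0 < q.1 ∧ q.1 ∣ L) :
    floorComb l y = floorComb l (y % L) + (y / L : ℕ) * floorComb l L := by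
  induction l with
  | nil => simp [floorComb]
  | cons q l ih =>
    have ih' := ih fun q hq => hl q (List.mem_cons_of_mem _ hq)
    obtain ⟨h0, c, hc⟩ := hl q List.mem_cons_self
    simp only [floorComb, List.map_cons, List.sum_cons] at ih' ⊢
    rw [ih']
    have h1 : y / q.1 = y % L / q.1 + L / q.1 * (y / L) := by
      conv_lhs => rw [← Nat.mod_add_div y L]
      rw [hc, Nat.mul_div_cancel_left _ h0, mul_assoc, Nat.add_mul_div_left _ _ h0]
    rw [h1]
    push_cast
    ring

open Chebyshev ArithmeticFunction in
lemma psi_div_eq_sum (n k : ℕ) (hk : 0 < k) :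
    ψ ((n / k : ℕ) : ℝ) =
      ∑ d ∈ Finset.Ioc 0 n, vonMangoldt d * (if k ≤ n / d then 1 else 0) := by
  rw [psi, Nat.floor_natCast]
  simp only [mul_ite, mul_one, mul_zero]
  rw [← Finset.sum_filter]
  refine Finset.sum_congr ?_ fun _ _ => rfl
  ext d
  simp only [Finset.mem_Ioc, Finset.mem_filter]
  constructor
  · rintro ⟨h1, h2⟩
    have := (Nat.le_div_iff_mul_le hk).1 h2
    refine ⟨⟨h1, by nlinarith⟩, (Nat.le_div_iff_mul_le h1).2 (by linarith)⟩
  · rintro ⟨⟨h1, _⟩, h2⟩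
    have := (Nat.le_div_iff_mul_le h1).1 h2
    exact ⟨h1, (Nat.le_div_iff_mul_le hk).2 (by linarith)⟩

/-- Pairs `(k, e)` of Chebyshev type used for the upper bound of `ψ`. -/
def upperPairs : List (ℕ × ℤ) :=
  [(1, 1), (2, -1), (3, -1), (5, -1), (7, -1), (10, 1), (14, 1), (20, -1), (21, 1), (30, 1),
    (42, -1), (420, -1)]

/-- Pairs `(k, e)` of Chebyshev type used for the lower bound of `2 ψ`. -/
def lowerPairs : List (ℕ × ℤ) :=
  [(1, 2), (2, -2), (3, -2), (5, -2), (6, 1), (7, -2), (10, 1), (14, 1), (21, 1), (42, -1),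
    (70, -1), (210, 1)]

lemma floorComb_upperPairs_nonneg (y : ℕ) : 0 ≤ floorComb upperPairs y := by
  rw [floorComb_eq_mod upperPairs 420 y (by decide),
    show floorComb upperPairs 420 = 0 by decide +kernel, mul_zero, add_zero]
  exact (by decide +kernel : ∀ r < 420, 0 ≤ floorComb upperPairs r) _ (Nat.mod_lt _ (by norm_num))

lemma floorComb_lowerPairs_le (y : ℕ) : floorComb lowerPairs y ≤ 3 := by
  rw [floorComb_eq_mod lowerPairs 210 y (by decide),
    show floorComb lowerPairs 210 = 0 by decide +kernel, mul_zero, add_zero]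
  exact (by decide +kernel : ∀ r < 210, floorComb lowerPairs r ≤ 3) _ (Nat.mod_lt _ (by norm_num))

open Chebyshev ArithmeticFunction in
lemma psi_le_add_logFactorialComb (n : ℕ) :
    ψ (n : ℝ) ≤ ψ ((n / 6 : ℕ) : ℝ) + logFactorialComb upperPairs n := by
  have h1 : ψ (n : ℝ) = ψ ((n / 1 : ℕ) : ℝ) := by simp
  rw [h1, psi_div_eq_sum n 1 one_pos, psi_div_eq_sum n 6 (by norm_num), logFactorialComb_eq_sum,
    ← Finset.sum_add_distrib]
  refine Finset.sum_le_sum fun d hd => ?_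
  rw [← mul_add]
  refine mul_le_mul_of_nonneg_left ?_ vonMangoldt_nonneg
  have h2 : ((if 1 ≤ n / d then 1 else 0 : ℤ)) ≤
      (if 6 ≤ n / d then 1 else 0) + floorComb upperPairs (n / d) := by
    generalize n / d = y
    have h3 := floorComb_upperPairs_nonneg y
    by_cases h6 : 6 ≤ y
    · simp only [h6, if_true]; split_ifs <;> linarith
    · have h7 : ∀ y < 6, ((if 1 ≤ y then 1 else 0 : ℤ)) ≤ floorComb upperPairs y := by
        decide +kernel
      simpa [h6] using h7 y (by omega)
  exact_mod_cast h2

open Chebyshev ArithmeticFunction in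
lemma logFactorialComb_le_two_psi (n : ℕ) :
    logFactorialComb lowerPairs n + ψ ((n / 6 : ℕ) : ℝ) ≤
      2 * ψ (n : ℝ) + ψ ((n / 11 : ℕ) : ℝ) + ψ ((n / 13 : ℕ) : ℝ) := by
  have h1 : ψ (n : ℝ) = ψ ((n / 1 : ℕ) : ℝ) := by simp
  rw [h1, psi_div_eq_sum n 1 one_pos, psi_div_eq_sum n 6 (by norm_num),
    psi_div_eq_sum n 11 (by norm_num), psi_div_eq_sum n 13 (by norm_num), logFactorialComb_eq_sum,
    Finset.mul_sum, ← Finset.sum_add_distrib, ← Finset.sum_add_distrib, ← Finset.sum_add_distrib]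
  refine Finset.sum_le_sum fun d hd => ?_
  rw [mul_left_comm, ← mul_add, ← mul_add, ← mul_add]
  refine mul_le_mul_of_nonneg_left ?_ vonMangoldt_nonneg
  have h2 : floorComb lowerPairs (n / d) + (if 6 ≤ n / d then 1 else 0) ≤
      2 * (if 1 ≤ n / d then 1 else 0) + (if 11 ≤ n / d then 1 else 0)
        + (if 13 ≤ n / d then 1 else 0) := by
    generalize n / d = y
    have h3 := floorComb_lowerPairs_le y
    by_cases h6 : 13 ≤ y
    · rw [if_pos (by omega), if_pos (by omega), if_pos (by omega), if_pos h6]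
      linarith
    · have h7 : ∀ y < 13, floorComb lowerPairs y + (if 6 ≤ y then 1 else 0) ≤
          2 * (if 1 ≤ y then 1 else 0) + (if 11 ≤ y then 1 else 0)
            + (if 13 ≤ y then 1 else 0) := by
        decide +kernel
      exact h7 y (by omega)
  exact_mod_cast h2

lemma log_factorial_le_stirling {m : ℕ} (hm : 1 ≤ m) :
    Real.log (m ! : ℝ) ≤ m * Real.log m - m + Real.log m / 2 + 1 := by
  have h := Stirling.log_stirlingSeq'_antitone (Nat.zero_le (m - 1))
  simp only [Function.comp_apply] at h
  rw [show (m - 1).succ = m by omega, show Nat.succ 0 = 1 from rfl,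
    Stirling.log_stirlingSeq_formula, Stirling.log_stirlingSeq_formula] at h
  have hm0 : (m : ℝ) ≠ 0 := by positivity
  rw [Real.log_mul two_ne_zero hm0, Real.log_div hm0 (Real.exp_ne_zero 1), Real.log_exp] at h
  simp only [Nat.factorial_one, Nat.cast_one, Real.log_one, mul_one, one_div, Real.log_inv,
    Real.log_exp] at h
  linarith

lemma mul_log_ge_tangent {x y : ℝ} (hx : 0 < x) (hy : 0 < y) :
    y * Real.log x + y - x ≤ y * Real.log y := by
  have h := Real.one_sub_inv_le_log_of_pos (div_pos hy hx)
  rw [Real.log_div hy.ne' hx.ne', inv_div] at h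
  have h2 := mul_le_mul_of_nonneg_left h hy.le
  have h3 : y * (1 - x / y) = y - x := by field_simp
  linarith

lemma abs_log_factorial_div_sub_le {n k : ℕ} (hn : 1 ≤ n) (hk : 1 ≤ k) :
    |Real.log ((n / k)! : ℝ) - ((n / k : ℝ) * Real.log (n / k) - n / k + 1 / 2)| ≤
      Real.log n / 2 + 1 / 2 := by
  have hn0 : (0 : ℝ) < n := by positivity
  have hk0 : (0 : ℝ) < k := by positivity
  have hlogn : 0 ≤ Real.log n := Real.log_nonneg (by exact_mod_cast hn)
  obtain ⟨m, hm⟩ : ∃ m, m = n / k := ⟨_, rfl⟩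
  obtain ⟨y, hy⟩ : ∃ y : ℝ, y = n / k := ⟨_, rfl⟩
  have hy0 : 0 < y := by rw [hy]; positivity
  have hmy : (m : ℝ) ≤ y := by rw [hm, hy]; exact Nat.cast_div_le
  have hym : y < m + 1 := by
    rw [hm, hy, div_lt_iff₀ hk0]
    exact_mod_cast Nat.lt_mul_of_div_lt (Nat.lt_succ_self (n / k)) (by omega)
  rw [← hm, ← hy, abs_le]
  rcases Nat.eq_zero_or_pos m with h0 | h0
  · simp only [h0, Nat.factorial_zero, Nat.cast_one, Real.log_one, Nat.cast_zero, zero_add]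
      at hym ⊢
    have h1 := mul_log_ge_tangent one_pos hy0
    have h2 := mul_nonpos_of_nonneg_of_nonpos hy0.le (Real.log_nonpos hy0.le hym.le)
    simp only [Real.log_one, mul_zero] at h1
    constructor <;> linarith
  · have hm1 : (1 : ℝ) ≤ m := by exact_mod_cast h0
    have hmn : m ≤ n := by rw [hm]; exact Nat.div_le_self _ _
    have hmn' : (m : ℝ) ≤ n := by exact_mod_cast hmn
    constructor
    · have h1 := Stirling.le_log_factorial_stirling (Nat.succ_ne_zero m)
      rw [Nat.factorial_succ, Nat.cast_mul, Real.log_mul (x := ((m + 1 : ℕ) : ℝ)) (by positivity)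
        (by positivity)] at h1
      push_cast at h1
      have h2 := mul_log_ge_tangent hy0 (show (0 : ℝ) < m + 1 by positivity)
      have h3 := mul_le_mul_of_nonneg_right hym.le (Real.log_nonneg (hm1.trans hmy))
      have h4 : Real.log (m + 1) ≤ Real.log (2 * Real.pi) + Real.log n := by
        rw [← Real.log_mul (by positivity) hn0.ne']
        refine Real.log_le_log (by positivity) ?_
        nlinarith [Real.pi_gt_three]
      linarith
    · have h1 := log_factorial_le_stirling h0
      have h2 := mul_log_ge_tangent (show (0 : ℝ) < m by positivity) hy0
      have h3 := mul_le_mul_of_nonneg_right hmy (Real.log_nonneg hm1)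
      have h4 : Real.log m ≤ Real.log n := Real.log_le_log (by positivity) hmn'
      linarith

lemma abs_logFactorialComb_sub_le (l : List (ℕ × ℤ)) (hl : ∀ q ∈ l, 1 ≤ q.1) {n : ℕ}
    (hn : 1 ≤ n) :
    |logFactorialComb l n -
        ((l.map fun q => (q.2 : ℝ) / q.1).sum * (n * Real.log n - n)
          - n * (l.map fun q => (q.2 : ℝ) * (Real.log q.1 / q.1)).sum
          + (l.map fun q => (q.2 : ℝ)).sum / 2)| ≤
      (l.map fun q => |(q.2 : ℝ)|).sum * (Real.log n / 2 + 1 / 2) := by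
  induction l with
  | nil => simp [logFactorialComb]
  | cons q l ih =>
    have ih' := ih fun q hq => hl q (List.mem_cons_of_mem _ hq)
    have hq := hl q List.mem_cons_self
    have h1 := mul_le_mul_of_nonneg_left (abs_log_factorial_div_sub_le hn hq)
      (abs_nonneg (q.2 : ℝ))
    rw [← abs_mul] at h1
    simp only [logFactorialComb, List.map_cons, List.sum_cons] at ih' ⊢
    have hn0 : (n : ℝ) ≠ 0 := by positivity
    have hq0 : (q.1 : ℝ) ≠ 0 := by positivity
    rw [Real.log_div hn0 hq0] at h1
    refine le_trans (le_of_eq_of_le ?_ (abs_add_le _ _)) ((add_le_add h1 ih').trans_eq (by ring))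
    congr 1
    ring

lemma log_seven_bounds : 1.9459 < Real.log 7 ∧ Real.log 7 < 1.94592 := by
  have h2 := Real.log_two_gt_d9
  have h2' := Real.log_two_lt_d9
  have h3 := Real.log_three_gt_d9
  have h3' := Real.log_three_lt_d9
  have h5 := Real.log_five_gt_d9
  have h5' := Real.log_five_lt_d9
  have e1 : Real.log 2400 = 5 * Real.log 2 + Real.log 3 + 2 * Real.log 5 := by
    rw [show (2400 : ℝ) = 2 ^ 5 * 3 * 5 ^ 2 by norm_num, Real.log_mul (by norm_num) (by norm_num),
      Real.log_mul (by norm_num) (by norm_num), Real.log_pow, Real.log_pow]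
    norm_num
  have e2 : 4 * Real.log 7 = Real.log 2400 + Real.log (2401 / 2400) := by
    rw [← Real.log_mul (by norm_num) (by norm_num),
      show (2400 * (2401 / 2400) : ℝ) = 7 ^ 4 by norm_num, Real.log_pow]
    norm_num
  have e3 := Real.one_sub_inv_le_log_of_pos (show (0 : ℝ) < 2401 / 2400 by norm_num)
  have e4 := Real.log_le_sub_one_of_pos (show (0 : ℝ) < 2401 / 2400 by norm_num)
  constructor <;> linarith

lemma log_composite_values :
    Real.log 6 = Real.log 2 + Real.log 3 ∧ Real.log 10 = Real.log 2 + Real.log 5 ∧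
    Real.log 14 = Real.log 2 + Real.log 7 ∧ Real.log 20 = 2 * Real.log 2 + Real.log 5 ∧
    Real.log 21 = Real.log 3 + Real.log 7 ∧
    Real.log 30 = Real.log 2 + Real.log 3 + Real.log 5 ∧
    Real.log 42 = Real.log 2 + Real.log 3 + Real.log 7 ∧
    Real.log 70 = Real.log 2 + Real.log 5 + Real.log 7 ∧
    Real.log 210 = Real.log 2 + Real.log 3 + Real.log 5 + Real.log 7 ∧
    Real.log 420 = 2 * Real.log 2 + Real.log 3 + Real.log 5 + Real.log 7 := by
  have h4 : 2 * Real.log 2 = Real.log 4 := by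
    rw [show (4 : ℝ) = 2 ^ 2 by norm_num, Real.log_pow]; norm_num
  rw [h4]
  refine ⟨?_, ?_, ?_, ?_, ?_, ?_, ?_, ?_, ?_, ?_⟩ <;>
    (repeat rw [← Real.log_mul (by norm_num) (by norm_num)]) <;> norm_num

lemma logFactorialComb_upperPairs_le {n : ℕ} (hn : 1 ≤ n) :
    logFactorialComb upperPairs n ≤ 0.888703 * n + 6 * Real.log n + 5 := by
  have h := (abs_le.1 (abs_logFactorialComb_sub_le upperPairs (by decide) hn)).2
  obtain ⟨e6, e10, e14, e20, e21, e30, e42, e70, e210, e420⟩ := log_composite_values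
  rw [upperPairs] at h ⊢
  simp only [List.map_cons, List.map_nil, List.sum_cons, List.sum_nil] at h
  norm_num at h
  rw [e10, e14, e20, e21, e30, e42, e420] at h
  have hn0 : (0 : ℝ) ≤ n := by positivity
  have a2 := mul_le_mul_of_nonneg_left Real.log_two_gt_d9.le hn0
  have a2' := mul_le_mul_of_nonneg_left Real.log_two_lt_d9.le hn0
  have a3 := mul_le_mul_of_nonneg_left Real.log_three_gt_d9.le hn0
  have a3' := mul_le_mul_of_nonneg_left Real.log_three_lt_d9.le hn0
  have a5 := mul_le_mul_of_nonneg_left Real.log_five_gt_d9.le hn0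
  have a5' := mul_le_mul_of_nonneg_left Real.log_five_lt_d9.le hn0
  have a7 := mul_le_mul_of_nonneg_left log_seven_bounds.1.le hn0
  have a7' := mul_le_mul_of_nonneg_left log_seven_bounds.2.le hn0
  linarith

lemma le_logFactorialComb_lowerPairs {n : ℕ} (hn : 1 ≤ n) :
    1.88715 * n - 8.5 * Real.log n - 10 ≤ logFactorialComb lowerPairs n := by
  have h := (abs_le.1 (abs_logFactorialComb_sub_le lowerPairs (by decide) hn)).1
  obtain ⟨e6, e10, e14, e20, e21, e30, e42, e70, e210, e420⟩ := log_composite_values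
  rw [lowerPairs] at h ⊢
  simp only [List.map_cons, List.map_nil, List.sum_cons, List.sum_nil] at h
  norm_num at h
  rw [e6, e10, e14, e21, e42, e70, e210] at h
  have hn0 : (0 : ℝ) ≤ n := by positivity
  have a2 := mul_le_mul_of_nonneg_left Real.log_two_gt_d9.le hn0
  have a2' := mul_le_mul_of_nonneg_left Real.log_two_lt_d9.le hn0
  have a3 := mul_le_mul_of_nonneg_left Real.log_three_gt_d9.le hn0
  have a3' := mul_le_mul_of_nonneg_left Real.log_three_lt_d9.le hn0
  have a5 := mul_le_mul_of_nonneg_left Real.log_five_gt_d9.le hn0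
  have a5' := mul_le_mul_of_nonneg_left Real.log_five_lt_d9.le hn0
  have a7 := mul_le_mul_of_nonneg_left log_seven_bounds.1.le hn0
  have a7' := mul_le_mul_of_nonneg_left log_seven_bounds.2.le hn0
  linarith

open Chebyshev in
lemma psi_natCast_le {n : ℕ} (hn : 1 ≤ n) : ψ (n : ℝ) ≤ 1.07 * n + 30 * Real.log n + 5 := by
  induction n using Nat.strong_induction_on with
  | _ n ih =>
    have h := psi_le_add_logFactorialComb n
    have hF := logFactorialComb_upperPairs_le hn
    have hn0 : (0 : ℝ) < n := by positivity
    have hlog : 0 ≤ Real.log n := Real.log_nonneg (by exact_mod_cast hn)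
    rcases Nat.eq_zero_or_pos (n / 6) with h0 | h0
    · rw [h0, Nat.cast_zero, psi_zero] at h
      linarith
    · have h1 := ih (n / 6) (Nat.div_lt_self hn (by norm_num)) h0
      have h2 : ((n / 6 : ℕ) : ℝ) ≤ n / 6 := by exact_mod_cast Nat.cast_div_le (m := n) (n := 6)
      have h3 : Real.log ((n / 6 : ℕ) : ℝ) ≤ Real.log n - Real.log 6 := by
        rw [← Real.log_div hn0.ne' (by norm_num)]
        exact Real.log_le_log (by positivity) h2
      have h4 := Real.log_le_sub_one_of_pos (show (0 : ℝ) < n / 2 ^ 11 by positivity)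
      rw [Real.log_div hn0.ne' (by norm_num), Real.log_pow] at h4
      rw [log_composite_values.1] at h3
      have := Real.log_two_gt_d9
      have := Real.log_two_lt_d9
      have := Real.log_three_gt_d9
      norm_num at h4
      linarith

open Chebyshev in
lemma psi_natCast_ge (n : ℕ) : 0.93 * n - 700 ≤ ψ (n : ℝ) := by
  induction n using Nat.strong_induction_on with
  | _ n ih =>
    rcases Nat.eq_zero_or_pos n with rfl | hn
    · norm_num
    have h := logFactorialComb_le_two_psi n
    have hF := le_logFactorialComb_lowerPairs hn
    have hn0 : (0 : ℝ) < n := by positivity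
    have hlog : 0 ≤ Real.log n := Real.log_nonneg (by exact_mod_cast hn)
    have h1 := ih (n / 6) (Nat.div_lt_self hn (by norm_num))
    have h2 : (n / 6 : ℝ) - 1 ≤ ((n / 6 : ℕ) : ℝ) := by
      have : (n : ℝ) < (n / 6 : ℕ) * 6 + 6 := by exact_mod_cast Nat.lt_div_mul_add (by norm_num)
      linarith
    have hk : ∀ k : ℕ, 0 < k →
        ψ ((n / k : ℕ) : ℝ) ≤ 1.07 * (n / k : ℝ) + 30 * Real.log n + 5 := by
      intro k hk
      have h4 : ((n / k : ℕ) : ℝ) ≤ n / k := Nat.cast_div_le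
      rcases Nat.eq_zero_or_pos (n / k) with h0 | h0
      · rw [h0, Nat.cast_zero, psi_zero]
        positivity
      · have h5 := psi_natCast_le h0
        have h6 : Real.log ((n / k : ℕ) : ℝ) ≤ Real.log n :=
          Real.log_le_log (by positivity) (by exact_mod_cast Nat.div_le_self n k)
        linarith
    have h11 := hk 11 (by norm_num)
    have h13 := hk 13 (by norm_num)
    have h4 := Real.log_le_sub_one_of_pos (show (0 : ℝ) < n / 2 ^ 15 by positivity)
    rw [Real.log_div hn0.ne' (by norm_num), Real.log_pow] at h4
    have := Real.log_two_lt_d9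
    norm_num at h4 h11 h13
    linarith

open Chebyshev in
lemma psi_le_add_log {x : ℝ} (hx : 1 ≤ x) : ψ x ≤ 1.07 * x + 30 * Real.log x + 5 := by
  rw [psi_eq_psi_coe_floor]
  have h1 : 1 ≤ ⌊x⌋₊ := Nat.le_floor (by exact_mod_cast hx)
  have h2 := Nat.floor_le (zero_le_one.trans hx)
  have h3 : Real.log (⌊x⌋₊ : ℝ) ≤ Real.log x := Real.log_le_log (by positivity) h2
  linarith [psi_natCast_le h1]

open Chebyshev in
lemma psi_le_linear {x : ℝ} (hx : 0 ≤ x) : ψ x ≤ 1.1 * x + 200 := by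
  rcases lt_or_ge x 1 with h | h
  · rw [psi_eq_zero_of_le_one h.le]
    positivity
  · have h4 := Real.log_le_sub_one_of_pos (show (0 : ℝ) < x / 2 ^ 10 by positivity)
    rw [Real.log_div (by positivity) (by norm_num), Real.log_pow] at h4
    have := Real.log_two_lt_d9
    norm_num at h4
    linarith [psi_le_add_log h]

open Chebyshev in
lemma psi_ge_linear (x : ℝ) : 0.93 * x - 701 ≤ ψ x := by
  rw [psi_eq_psi_coe_floor]
  linarith [psi_natCast_ge ⌊x⌋₊, Nat.lt_floor_add_one x]

open Chebyshev in
lemma psi_sub_theta_le_sqrt {x : ℝ} (hx : 1 ≤ x) : ψ x - θ x ≤ 1.25 * √x + 680 := by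
  have hx0 : 0 ≤ x := by linarith
  have h := psi_sub_theta_le_psi_add_psi_add_psi x
  obtain ⟨s, hs⟩ : ∃ s : ℝ, s = x ^ (6 : ℝ)⁻¹ := ⟨_, rfl⟩
  have hs1 : 1 ≤ s := hs ▸ Real.one_le_rpow hx (by norm_num)
  have e2 : x ^ (2 : ℝ)⁻¹ = s ^ 3 := by
    rw [hs, ← Real.rpow_mul_natCast hx0]; norm_num
  have e3 : x ^ (3 : ℝ)⁻¹ = s ^ 2 := by
    rw [hs, ← Real.rpow_mul_natCast hx0]; norm_num
  have e5 : x ^ (5 : ℝ)⁻¹ ≤ s ^ 2 := by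
    rw [← e3]
    exact Real.rpow_le_rpow_of_exponent_le hx (by norm_num)
  have es : √x = s ^ 3 := by rw [Real.sqrt_eq_rpow, ← e2]; norm_num
  rw [e2, e3] at h
  have h2 := psi_le_linear (show 0 ≤ s ^ 3 by positivity)
  have h3 := psi_le_linear (show 0 ≤ s ^ 2 by positivity)
  have h5 := (psi_mono e5).trans h3
  rw [es]
  linarith [mul_nonneg (by linarith : 0 ≤ 0.15 * s + 0.8) (sq_nonneg (s - 10))]

/-- The product of the `m` successive terms `y + 1, y + 3, …, y + 2 m - 1`. -/
def stepTwoProd (y m : ℕ) : ℕ := ∏ i ∈ Finset.range m, (y + 2 * i + 1)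

lemma stepTwoProd_ne_zero (y m : ℕ) : stepTwoProd y m ≠ 0 :=
  Finset.prod_ne_zero_iff.2 fun _ _ => Nat.succ_ne_zero _

lemma doubleFactorial_two_mul_add_sub_one (k m : ℕ) :
    (2 * (k + m) - 1)‼ = (2 * k - 1)‼ * stepTwoProd (2 * k) m := by
  induction m with
  | zero => simp [stepTwoProd]
  | succ m ih =>
    rw [stepTwoProd, Finset.prod_range_succ, ← stepTwoProd, ← mul_assoc, ← ih,
      show 2 * (k + (m + 1)) - 1 = 2 * (k + m) + 1 by omega, Nat.doubleFactorial_add_one]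
    ring

lemma card_filter_dvd_step_two_le {q : ℕ} (hq : Odd q) (y m : ℕ) :
    ((Finset.range m).filter fun i => q ∣ y + 2 * i + 1).card ≤ m / q + 1 := by
  rcases ((Finset.range m).filter fun i => q ∣ y + 2 * i + 1).eq_empty_or_nonempty with h | ⟨v, hv⟩
  · simp [h]
  · have hsub : ((Finset.range m).filter fun i => q ∣ y + 2 * i + 1) ⊆
        (Finset.range m).filter fun i => i ≡ v [MOD q] := by
      intro i hi
      rw [Finset.mem_filter] at hi hv ⊢
      refine ⟨hi.1, ?_⟩
      have h1 : y + 2 * i + 1 ≡ y + 2 * v + 1 [MOD q] :=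
        ((Nat.modEq_zero_iff_dvd.2 hi.2).trans (Nat.modEq_zero_iff_dvd.2 hv.2).symm)
      have h2 : 2 * i ≡ 2 * v [MOD q] := Nat.ModEq.add_left_cancel' y
        (Nat.ModEq.add_right_cancel' 1 h1)
      exact Nat.ModEq.cancel_left_of_coprime (Nat.coprime_two_right.2 hq) h2
    refine (Finset.card_le_card hsub).trans ?_
    rw [← Nat.count_eq_card_filter_range, Nat.count_modEq_card _ hq.pos]
    split_ifs <;> omega

lemma factorization_stepTwoProd_le {p : ℕ} (hp : p.Prime) (hp2 : p ≠ 2) (y m : ℕ) :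
    (stepTwoProd y m).factorization p ≤
      (m !).factorization p + Nat.log p (y + 2 * m) := by
  have hodd : Odd p := hp.odd_of_ne_two hp2
  obtain ⟨b, hb⟩ : ∃ b, b = Nat.log p (y + 2 * m) + 1 := ⟨_, rfl⟩
  have hb1 : y + 2 * m < p ^ b := hb ▸ Nat.lt_pow_succ_log_self hp.one_lt _
  have h1 : (stepTwoProd y m).factorization p =
      ∑ j ∈ Finset.Ico 1 b, ((Finset.range m).filter fun i => p ^ j ∣ y + 2 * i + 1).card := by
    rw [stepTwoProd, Nat.factorization_prod_apply fun _ _ => Nat.succ_ne_zero _]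
    simp_rw [Finset.card_filter]
    rw [Finset.sum_comm]
    refine Finset.sum_congr rfl fun i hi => ?_
    rw [Finset.mem_range] at hi
    rw [Nat.factorization_eq_card_pow_dvd_of_lt hp (Nat.succ_pos _) (by omega : _ < p ^ b),
      Finset.card_filter]
  have h2 : (m !).factorization p = ∑ j ∈ Finset.Ico 1 b, m / p ^ j :=
    Nat.factorization_factorial hp (hb ▸ Nat.lt_succ_of_le (Nat.log_mono_right (by omega)))
  rw [h1, h2]
  refine (Finset.sum_le_sum fun j _ => card_filter_dvd_step_two_le hodd.pow y m).trans ?_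
  rw [Finset.sum_add_distrib]
  simp [hb]

/-- The odd primes up to `n`. -/
def oddPrimesLE (n : ℕ) : Finset ℕ := (Nat.primesLE n).erase 2

lemma mem_oddPrimesLE {n p : ℕ} : p ∈ oddPrimesLE n ↔ p ≠ 2 ∧ p ≤ n ∧ p.Prime := by
  rw [oddPrimesLE, Finset.mem_erase, Nat.mem_primesLE]

lemma stepTwoProd_mul_le {y m : ℕ} (hy : Even y)
    (hs : ∀ p : ℕ, p.Prime → p ∣ stepTwoProd y m → p ≤ 4 * m + 1) :
    stepTwoProd y m * 2 ^ (m !).factorization 2 ≤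
      m ! * ∏ p ∈ oddPrimesLE (4 * m + 1), p ^ Nat.log p (y + 2 * m) := by
  have hR : ∏ p ∈ oddPrimesLE (4 * m + 1), p ^ Nat.log p (y + 2 * m) ≠ 0 :=
    Finset.prod_ne_zero_iff.2 fun p hp => pow_ne_zero _ (mem_oddPrimesLE.1 hp).2.2.ne_zero
  have hP := stepTwoProd_ne_zero y m
  have hm0 := Nat.factorial_ne_zero m
  refine Nat.le_of_dvd (Nat.pos_of_ne_zero (mul_ne_zero hm0 hR)) ?_
  rw [← Nat.factorization_le_iff_dvd (mul_ne_zero hP (by positivity)) (mul_ne_zero hm0 hR)]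
  intro p
  by_cases hp : p.Prime
  swap
  · simp [Nat.factorization_eq_zero_of_not_prime _ hp]
  rw [Nat.factorization_mul hP (by positivity), Nat.factorization_mul hm0 hR, Finsupp.add_apply,
    Finsupp.add_apply, Nat.factorization_pow, Finsupp.smul_apply,
    Nat.prime_two.factorization, smul_eq_mul]
  rcases eq_or_ne p 2 with rfl | hp2
  · have : (stepTwoProd y m).factorization 2 = 0 := by
      refine Nat.factorization_eq_zero_of_not_dvd ?_
      rw [← even_iff_two_dvd, Nat.not_even_iff_odd, stepTwoProd]
      refine Finset.prod_induction _ Odd (fun _ _ => Odd.mul) odd_one fun i _ => ?_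
      exact (hy.add (even_two_mul i)).add_one
    simp [this]
  · rw [Finsupp.single_eq_of_ne hp2, mul_zero, add_zero]
    by_cases hp4 : p ≤ 4 * m + 1
    · refine (factorization_stepTwoProd_le hp hp2 y m).trans (Nat.add_le_add_left ?_ _)
      rw [Nat.factorization_prod_apply fun q hq =>
        pow_ne_zero _ (mem_oddPrimesLE.1 hq).2.2.ne_zero]
      refine le_trans ?_ (Finset.single_le_sum (fun _ _ => Nat.zero_le _)
        (mem_oddPrimesLE.2 ⟨hp2, hp4, hp⟩))
      simp [Nat.factorization_pow, hp.factorization]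
    · rw [Nat.factorization_eq_zero_of_not_dvd fun h => hp4 (hs p hp h)]
      exact Nat.zero_le _

lemma prime_dvd_stepTwoProd_le {k m : ℕ}
    (hsmooth : ∀ p : ℕ, p.Prime → 4 * m + 1 < p →
      padicValRat p (((2 * (k + m) - 1)‼ : ℚ) / (((2 * k - 1)‼ : ℚ) * 2 ^ m * (m ! : ℚ))) ≤ 0)
    {p : ℕ} (hp : p.Prime) (hpd : p ∣ stepTwoProd (2 * k) m) : p ≤ 4 * m + 1 := by
  by_contra! h
  have h1 := hsmooth p hp h
  have := Fact.mk hp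
  have hd : (((2 * k - 1)‼ : ℕ) : ℚ) ≠ 0 := by
    exact_mod_cast (Nat.doubleFactorial_pos _).ne'
  have h2 : (((2 * (k + m) - 1)‼ : ℚ) / (((2 * k - 1)‼ : ℚ) * 2 ^ m * (m ! : ℚ))) =
      ((stepTwoProd (2 * k) m : ℕ) : ℚ) / ((2 ^ m * m ! : ℕ) : ℚ) := by
    rw [doubleFactorial_two_mul_add_sub_one]
    push_cast
    field_simp
  rw [h2, padicValRat.div (by exact_mod_cast stepTwoProd_ne_zero _ _) (by positivity),
    padicValRat.of_nat, padicValRat.of_nat] at h1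
  have h3 : padicValNat p (2 ^ m * m !) = 0 := by
    refine padicValNat.eq_zero_of_not_dvd fun h4 => ?_
    rcases hp.dvd_mul.1 h4 with h5 | h5
    · have := Nat.le_of_dvd two_pos (hp.dvd_of_dvd_pow h5)
      have := hp.two_le
      have hm : m = 0 := by omega
      subst hm
      simp at h5
      omega
    · have := hp.dvd_factorial.1 h5
      omega
  have h4 := one_le_padicValNat_of_dvd (stepTwoProd_ne_zero (2 * k) m) hpd
  rw [h3, Nat.cast_zero, sub_zero] at h1
  omega

lemma pow_le_stepTwoProd_sq (y m : ℕ) : (y * (y + 2 * m)) ^ m ≤ stepTwoProd y m ^ 2 := by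
  have h1 : stepTwoProd y m ^ 2 =
      ∏ i ∈ Finset.range m, (y + 2 * i + 1) * (y + 2 * (m - 1 - i) + 1) := by
    rw [Finset.prod_mul_distrib, Finset.prod_range_reflect (fun i => y + 2 * i + 1), sq, stepTwoProd]
  rw [h1]
  conv_lhs => rw [← Finset.card_range m, ← Finset.prod_const]
  rw [Finset.card_range]
  refine Finset.prod_le_prod' fun i hi => ?_
  rw [Finset.mem_range] at hi
  obtain ⟨j, rfl⟩ : ∃ j, m = i + j + 1 := ⟨m - 1 - i, by omega⟩
  rw [show i + j + 1 - 1 - i = j by omega]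
  nlinarith [Nat.zero_le (i * j)]

lemma sub_log_le_factorization_two_factorial (m : ℕ) :
    (m : ℝ) * Real.log 2 ≤
      ((m !).factorization 2 : ℝ) * Real.log 2 + Real.log m + Real.log 2 := by
  rcases Nat.eq_zero_or_pos m with rfl | hm
  · simp [Real.log_nonneg]
  have h1 := Nat.sub_one_mul_factorization_factorial (n := m) Nat.prime_two
  have h2 : (Nat.digits 2 m).sum ≤ Nat.log 2 m + 1 := by
    have h3 := List.sum_le_card_nsmul (Nat.digits 2 m) 1 fun d hd => by
      have := Nat.digits_lt_base one_lt_two hd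
      omega
    rwa [Nat.length_digits 2 m one_lt_two hm.ne', smul_eq_mul, mul_one] at h3
  have h4 : m ≤ (m !).factorization 2 + Nat.log 2 m + 1 := by omega
  have h5 : (Nat.log 2 m : ℝ) * Real.log 2 ≤ Real.log m := by
    rw [← Real.log_pow]
    exact Real.log_le_log (by positivity) (by exact_mod_cast Nat.pow_log_le_self 2 hm.ne')
  have h6 : (m : ℝ) ≤ (m !).factorization 2 + Nat.log 2 m + 1 := by exact_mod_cast h4
  have := mul_le_mul_of_nonneg_right h6 (Real.log_nonneg one_le_two)
  linarith

lemma smooth_log_inequality {y m : ℕ} (hm : 1 ≤ m) (hy0 : 0 < y) (hy : Even y)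
    (hs : ∀ p : ℕ, p.Prime → p ∣ stepTwoProd y m → p ≤ 4 * m + 1) :
    (m : ℝ) / 2 * (Real.log y + Real.log (y + 2 * m)) + m * (1 + Real.log 2) ≤
      m * Real.log m + 1.5 * Real.log m + 2 +
        ∑ p ∈ oddPrimesLE (4 * m + 1), (Nat.log p (y + 2 * m) : ℝ) * Real.log p := by
  have h1 := stepTwoProd_mul_le hy hs
  have hP := stepTwoProd_ne_zero y m
  have hprod : ∏ p ∈ oddPrimesLE (4 * m + 1), ((p : ℝ) ^ Nat.log p (y + 2 * m)) ≠ 0 :=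
    Finset.prod_ne_zero_iff.2 fun p hp =>
      pow_ne_zero _ (Nat.cast_ne_zero.2 (mem_oddPrimesLE.1 hp).2.2.ne_zero)
  have h2 : Real.log (stepTwoProd y m) + (m !).factorization 2 * Real.log 2 ≤
      Real.log (m !) +
        ∑ p ∈ oddPrimesLE (4 * m + 1), (Nat.log p (y + 2 * m) : ℝ) * Real.log p := by
    have h3 : ((stepTwoProd y m : ℕ) : ℝ) * 2 ^ (m !).factorization 2 ≤
        (m ! : ℝ) * ∏ p ∈ oddPrimesLE (4 * m + 1), ((p : ℝ) ^ Nat.log p (y + 2 * m)) := by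
      exact_mod_cast h1
    have h4 := Real.log_le_log (by positivity) h3
    rw [Real.log_mul (by exact_mod_cast hP) (by positivity), Real.log_pow,
      Real.log_mul (by positivity) hprod, Real.log_prod fun p hp =>
        pow_ne_zero _ (Nat.cast_ne_zero.2 (mem_oddPrimesLE.1 hp).2.2.ne_zero)] at h4
    simpa only [Real.log_pow] using h4
  have h5 : (m : ℝ) * (Real.log y + Real.log (y + 2 * m)) ≤ 2 * Real.log (stepTwoProd y m) := by
    have h6 : ((y : ℝ) * (y + 2 * m)) ^ m ≤ (stepTwoProd y m : ℝ) ^ 2 := by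
      exact_mod_cast pow_le_stepTwoProd_sq y m
    have h7 := Real.log_le_log (by positivity) h6
    rw [Real.log_pow, Real.log_pow, Real.log_mul (by positivity) (by positivity)] at h7
    exact_mod_cast h7
  have h8 := sub_log_le_factorization_two_factorial m
  have h9 := log_factorial_le_stirling hm
  have := Real.log_two_lt_d9
  linarith

open Chebyshev in
lemma sum_log_mul_log_le {M N : ℕ} (hMN : M ≤ N) :
    ∑ p ∈ oddPrimesLE M, (Nat.log p N : ℝ) * Real.log p ≤
      θ (M : ℝ) + (ψ (N : ℝ) - θ (N : ℝ)) := by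
  have h1 : ψ (N : ℝ) - θ (N : ℝ) =
      ∑ p ∈ Nat.primesLE N, ((Nat.log p N : ℝ) - 1) * Real.log p := by
    rw [psi_eq_sum_mul_log_prime, theta_eq_sum_primesLE_log, ← Finset.sum_sub_distrib]
    exact Finset.sum_congr rfl fun p _ => by ring
  have hnn : ∀ p ∈ Nat.primesLE N, 0 ≤ ((Nat.log p N : ℝ) - 1) * Real.log p := by
    intro p hp
    obtain ⟨hpN, hp⟩ := Nat.mem_primesLE.1 hp
    have h2 : 1 ≤ Nat.log p N := Nat.log_pos hp.one_lt hpN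
    have h3 : (1 : ℝ) ≤ Nat.log p N := by exact_mod_cast h2
    exact mul_nonneg (by linarith) (Real.log_natCast_nonneg p)
  have hsub : oddPrimesLE M ⊆ Nat.primesLE M := Finset.erase_subset _ _
  have hsub' : oddPrimesLE M ⊆ Nat.primesLE N := fun p hp => by
    obtain ⟨h2, h3⟩ := Nat.mem_primesLE.1 (hsub hp)
    exact Nat.mem_primesLE.2 ⟨h2.trans hMN, h3⟩
  have h4 := Finset.sum_le_sum_of_subset_of_nonneg hsub' fun p hp _ => hnn p hp
  have h5 : ∑ p ∈ oddPrimesLE M, Real.log p ≤ θ (M : ℝ) := by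
    rw [theta_eq_sum_primesLE_log]
    exact Finset.sum_le_sum_of_subset_of_nonneg hsub fun p _ _ => Real.log_natCast_nonneg p
  have h6 : ∑ p ∈ oddPrimesLE M, (Nat.log p N : ℝ) * Real.log p =
      ∑ p ∈ oddPrimesLE M, Real.log p +
        ∑ p ∈ oddPrimesLE M, ((Nat.log p N : ℝ) - 1) * Real.log p := by
    rw [← Finset.sum_add_distrib]
    exact Finset.sum_congr rfl fun p _ => by ring
  linarith

lemma log_le_two_pow (k : ℕ) {x : ℝ} (hx : 0 < x) :
    Real.log x ≤ k * Real.log 2 + x / 2 ^ k - 1 := by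
  have h := Real.log_le_sub_one_of_pos (show (0 : ℝ) < x / 2 ^ k by positivity)
  rw [Real.log_div hx.ne' (by positivity), Real.log_pow] at h
  linarith

/-- For `4 m ≤ y`, smoothness forces an explicit upper bound on `log y + log (y + 2 m)` in terms
of `√(y + 2 m)`. -/
lemma smooth_sqrt_inequality {y m : ℕ} (hm : 1 ≤ m) (hym : 4 * m ≤ y) (hy : Even y)
    (hs : ∀ p : ℕ, p.Prime → p ∣ stepTwoProd y m → p ≤ 4 * m + 1) :
    (m : ℝ) / 2 * (Real.log y + Real.log (y + 2 * m)) + m * (1 + Real.log 2) ≤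
      m * Real.log m + 4.28 * m + 1.25 * √(y + 2 * m) + 1.5 * Real.log m
        + 30 * Real.log (4 * m + 1) + 690 := by
  have h1 := smooth_log_inequality hm (by omega) hy hs
  have h2 := sum_log_mul_log_le (show 4 * m + 1 ≤ y + 2 * m by omega)
  have h3 := psi_sub_theta_le_sqrt (x := ((y + 2 * m : ℕ) : ℝ)) (by exact_mod_cast (by omega))
  have h4 := (Chebyshev.theta_le_psi _).trans
    (psi_le_add_log (x := ((4 * m + 1 : ℕ) : ℝ)) (by exact_mod_cast (by omega)))
  push_cast at h2 h3 h4
  linarith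

lemma le_log_of_five_thousand_le {x : ℝ} (hx : 5000 ≤ x) : 12 * Real.log 2 + 0.18 ≤ Real.log x := by
  have e1 : Real.log (5000 / 2 ^ 12 : ℝ) ≥ 1 - (5000 / 2 ^ 12 : ℝ)⁻¹ :=
    Real.one_sub_inv_le_log_of_pos (by positivity)
  rw [Real.log_div (by positivity) (by positivity), Real.log_pow] at e1
  have e2 := Real.log_le_log (by positivity) hx
  norm_num at e1 ⊢
  linarith

lemma not_smooth_of_mid {y m : ℕ} (hm : 200000 ≤ m) (h1 : 1276 * m ≤ 100 * y) (h2 : y ≤ 32 * m)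
    (hy : Even y) (hs : ∀ p : ℕ, p.Prime → p ∣ stepTwoProd y m → p ≤ 4 * m + 1) : False := by
  have h := smooth_sqrt_inequality (by omega) (by omega) hy hs
  have hmR : (200000 : ℝ) ≤ m := by exact_mod_cast hm
  have h1R : 1276 * (m : ℝ) ≤ 100 * y := by exact_mod_cast h1
  have h2R : (y : ℝ) ≤ 32 * m := by exact_mod_cast h2
  have hm0 : (0 : ℝ) < m := by linarith
  have hy0 : (0 : ℝ) < y := by linarith
  have hlog : 5.2380 + 2 * Real.log m ≤ Real.log y + Real.log (y + 2 * m) := by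
    have e1 : Real.log (188.3376 * (m * m)) ≤ Real.log (y * (y + 2 * m)) := by
      refine Real.log_le_log (by positivity) ?_
      nlinarith
    rw [Real.log_mul (by positivity) (by positivity), Real.log_mul (by positivity) (by positivity),
      Real.log_mul (by positivity) (by positivity)] at e1
    have e2 : 9 * Real.log 188.3376 ≥ 68 * Real.log 2 + 0.009 := by
      have e3 : Real.log (188.3376 ^ 9 / 2 ^ 68) ≥ 1 - (188.3376 ^ 9 / 2 ^ 68)⁻¹ :=
        Real.one_sub_inv_le_log_of_pos (by positivity)
      rw [Real.log_div (by positivity) (by positivity), Real.log_pow, Real.log_pow] at e3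
      norm_num at e3 ⊢
      linarith
    have := Real.log_two_gt_d9
    norm_num at e2 ⊢
    linarith
  have hsqrt : √((y : ℝ) + 2 * m) ≤ (34 * m / 2608 + 2608) / 2 := by
    refine Real.sqrt_le_iff.2 ⟨by positivity, ?_⟩
    nlinarith [sq_nonneg (34 * (m : ℝ) / 2608 - 2608)]
  have hl1 := log_le_two_pow 18 hm0
  have hl2 := log_le_two_pow 20 (show (0 : ℝ) < 4 * m + 1 by positivity)
  have := Real.log_two_gt_d9
  have := Real.log_two_lt_d9
  norm_num at hl1 hl2
  have h3 := mul_le_mul_of_nonneg_left hlog (show 0 ≤ (m : ℝ) / 2 by positivity)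
  have h4 := mul_le_mul_of_nonneg_left Real.log_two_gt_d9.le hm0.le
  linarith

lemma not_smooth_of_high {y m : ℕ} (hm : 5000 ≤ m) (h1 : 32 * m ≤ y)
    (h2 : y + 2 * m ≤ (4 * m + 1) ^ 2)
    (hy : Even y) (hs : ∀ p : ℕ, p.Prime → p ∣ stepTwoProd y m → p ≤ 4 * m + 1) : False := by
  have h := smooth_sqrt_inequality (by omega) (by omega) hy hs
  have hmR : (5000 : ℝ) ≤ m := by exact_mod_cast hm
  have h1R : 32 * (m : ℝ) ≤ y := by exact_mod_cast h1
  have h2R : (y : ℝ) + 2 * m ≤ (4 * m + 1) ^ 2 := by exact_mod_cast h2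
  have hm0 : (0 : ℝ) < m := by linarith
  have hy0 : (0 : ℝ) < y := by linarith
  have hlogm := le_log_of_five_thousand_le hmR
  have hll : Real.log y ≤ Real.log (y + 2 * m) := Real.log_le_log hy0 (by linarith)
  have hl1 := log_le_two_pow 13 hm0
  have hl2 := log_le_two_pow 15 (show (0 : ℝ) < 4 * m + 1 by positivity)
  have hlog2 := Real.log_two_gt_d9
  have hlog2' := Real.log_two_lt_d9
  norm_num at hl1 hl2
  have key : ∀ c B : ℝ, Real.log m + c ≤ Real.log y → √((y : ℝ) + 2 * m) ≤ B →
      m * (c + 1.6931) ≤ 4.28 * m + 1.25 * B + 1050 + 0.01 * m := by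
    intro c B hc hB
    have h3 := mul_le_mul_of_nonneg_left hc hm0.le
    have h4 := mul_le_mul_of_nonneg_left hll hm0.le
    have h5 := mul_le_mul_of_nonneg_left hlog2.le hm0.le
    linarith
  have hs0 := Real.sqrt_nonneg ((y : ℝ) + 2 * m)
  have hsq := Real.sq_sqrt (show (0 : ℝ) ≤ y + 2 * m by positivity)
  have hs4 : √((y : ℝ) + 2 * m) ≤ 4 * m + 1 := Real.sqrt_le_iff.2 ⟨by positivity, h2R⟩
  rcases le_or_gt (√((y : ℝ) + 2 * m)) (m / 2) with hA | hA
  · have e1 : Real.log (32 * m) ≤ Real.log y := Real.log_le_log (by positivity) h1R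
    rw [show (32 : ℝ) * m = 2 ^ 5 * m by norm_num, Real.log_mul (by positivity) (by positivity),
      Real.log_pow] at e1
    norm_num at e1
    have := key 3.465 (m / 2) (by linarith) hA
    linarith
  · have hyN : 16 * ((y : ℝ) + 2 * m) ≤ 17 * y := by linarith
    have hlogsq : ∀ k : ℤ, (m : ℝ) * 2 ^ k < √((y : ℝ) + 2 * m) →
        2 * Real.log m + (2 * k - 1) * Real.log 2 ≤ Real.log y := by
      intro k hk
      have e1 : (m : ℝ) ^ 2 * 2 ^ (2 * k - 1) ≤ y := by
        have e2 : ((m : ℝ) * 2 ^ k) ^ 2 ≤ y + 2 * m := by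
          rw [← hsq]
          exact pow_le_pow_left₀ (by positivity) hk.le 2
        have e3 : ((m : ℝ) * 2 ^ k) ^ 2 = 2 * (m ^ 2 * 2 ^ (2 * k - 1)) := by
          rw [mul_pow, ← zpow_natCast, ← zpow_natCast, ← zpow_mul, zpow_sub₀ two_ne_zero,
            mul_comm k]
          norm_num
          ring
        linarith
      have e4 := Real.log_le_log (by positivity) e1
      rw [Real.log_mul (by positivity) (by positivity), Real.log_pow, Real.log_zpow] at e4
      push_cast at e4
      linarith
    rcases le_or_gt (√((y : ℝ) + 2 * m)) (2 * m) with hB | hB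
    · have e1 := hlogsq (-1) (by norm_num; linarith)
      norm_num at e1
      have := key 6.4 (2 * m) (by linarith) hB
      linarith
    · have e1 := hlogsq 1 (by norm_num; linarith)
      norm_num at e1
      have := key 9.0 (4 * m + 1) (by linarith) hs4
      linarith

lemma card_oddPrimesLE_filter_le (M m : ℕ) :
    ((oddPrimesLE M).filter fun p => 8 * p ≤ m).card ≤ m / 16 := by
  have hmem : ∀ p ∈ (oddPrimesLE M).filter fun p => 8 * p ≤ m, p % 2 = 1 ∧ 3 ≤ p ∧ 8 * p ≤ m := by
    intro p hp
    obtain ⟨hp1, hp2⟩ := Finset.mem_filter.1 hp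
    obtain ⟨h2, -, hp⟩ := mem_oddPrimesLE.1 hp1
    have := hp.two_le
    exact ⟨hp.eq_two_or_odd.resolve_left h2, by omega, hp2⟩
  have h := Finset.card_le_card_of_injOn (t := Finset.Ioc 0 (m / 16)) (fun p => p / 2)
    (s := (oddPrimesLE M).filter fun p => 8 * p ≤ m)
    (fun p hp => by
      have := hmem p hp
      simp only [Finset.coe_Ioc, Set.mem_Ioc]
      omega)
    (fun p hp q hq hpq => by
      have := hmem p hp
      have := hmem q hq
      simp only at hpq
      omega)
  simpa using h

open Chebyshev in
lemma card_oddPrimesLE_mul_log_le {m : ℕ} (hm : 5000 ≤ m) :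
    ((oddPrimesLE (4 * m + 1)).card : ℝ) * Real.log m ≤ m * (0.0625 * Real.log m + 4.9) := by
  have hmR : (5000 : ℝ) ≤ m := by exact_mod_cast hm
  have hm0 : (0 : ℝ) < m := by linarith
  have hlogm := le_log_of_five_thousand_le hmR
  have hlog2 := Real.log_two_gt_d9
  have hlog2' := Real.log_two_lt_d9
  have hsub : oddPrimesLE (4 * m + 1) ⊆ Nat.primesLE (4 * m + 1) := Finset.erase_subset _ _
  have hpt : ∀ p ∈ oddPrimesLE (4 * m + 1), Real.log m ≤
      (if 8 * p ≤ m then Real.log m else 0) + Real.log p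
        + 0.33 * (if p ≤ m then Real.log p else 0) := by
    intro p hp
    obtain ⟨-, -, hp⟩ := mem_oddPrimesLE.1 hp
    have hp0 : (0 : ℝ) < p := by exact_mod_cast hp.pos
    have hlp := Real.log_natCast_nonneg p
    split_ifs with h1 h2 h2
    · linarith
    · linarith
    · have h3 : Real.log (m / 2 ^ 3 : ℝ) ≤ Real.log p := by
        refine Real.log_le_log (by positivity) ?_
        rw [div_le_iff₀ (by positivity)]
        exact_mod_cast (by omega)
      rw [Real.log_div hm0.ne' (by norm_num), Real.log_pow] at h3
      norm_num at h3
      linarith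
    · have h3 := Real.log_le_log hm0 (show (m : ℝ) ≤ p by exact_mod_cast (by omega))
      linarith
  have hsum := Finset.sum_le_sum hpt
  rw [Finset.sum_add_distrib, Finset.sum_add_distrib, ← Finset.mul_sum, ← Finset.sum_filter,
    ← Finset.sum_filter, Finset.sum_const, Finset.sum_const, nsmul_eq_mul, nsmul_eq_mul] at hsum
  have hc : (((oddPrimesLE (4 * m + 1)).filter fun p => 8 * p ≤ m).card : ℝ) ≤ m / 16 :=
    (Nat.cast_le.2 (card_oddPrimesLE_filter_le (4 * m + 1) m)).trans Nat.cast_div_le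
  have h1 : ∑ p ∈ oddPrimesLE (4 * m + 1), Real.log p ≤ θ ((4 * m + 1 : ℕ) : ℝ) := by
    rw [theta_eq_sum_primesLE_log]
    exact Finset.sum_le_sum_of_subset_of_nonneg hsub fun p _ _ => Real.log_natCast_nonneg p
  have h2 : ∑ p ∈ (oddPrimesLE (4 * m + 1)).filter (fun p => p ≤ m), Real.log p ≤
      θ (m : ℝ) := by
    rw [theta_eq_sum_primesLE_log]
    refine Finset.sum_le_sum_of_subset_of_nonneg (fun p hp => ?_)
      fun p _ _ => Real.log_natCast_nonneg p
    obtain ⟨hp1, hp2⟩ := Finset.mem_filter.1 hp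
    exact Nat.mem_primesLE.2 ⟨hp2, (mem_oddPrimesLE.1 hp1).2.2⟩
  have h3 := (theta_le_psi _).trans
    (psi_le_add_log (x := ((4 * m + 1 : ℕ) : ℝ)) (by exact_mod_cast (by omega)))
  have h4 := (theta_le_psi _).trans (psi_le_add_log (x := (m : ℝ)) (by linarith))
  push_cast at h1 h3
  have hl1 := log_le_two_pow 13 hm0
  have hl2 := log_le_two_pow 15 (show (0 : ℝ) < 4 * m + 1 by positivity)
  norm_num at hl1 hl2
  have h5 := mul_le_mul_of_nonneg_right hc (show 0 ≤ Real.log m by linarith)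
  linarith

lemma not_smooth_of_huge {y m : ℕ} (hm : 5000 ≤ m) (h1 : (4 * m + 1) ^ 2 < y + 2 * m)
    (hy : Even y) (hs : ∀ p : ℕ, p.Prime → p ∣ stepTwoProd y m → p ≤ 4 * m + 1) : False := by
  have hym : 32 * m ≤ y := by nlinarith
  have h := smooth_log_inequality (by omega) (by omega) hy hs
  have hmR : (5000 : ℝ) ≤ m := by exact_mod_cast hm
  have h1R : (4 * (m : ℝ) + 1) ^ 2 < y + 2 * m := by exact_mod_cast h1
  have hymR : 32 * (m : ℝ) ≤ y := by exact_mod_cast hym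
  have hm0 : (0 : ℝ) < m := by linarith
  have hy0 : (0 : ℝ) < y := by linarith
  have hlogm := le_log_of_five_thousand_le hmR
  have hlog2 := Real.log_two_gt_d9
  have hlog2' := Real.log_two_lt_d9
  have hpi := card_oddPrimesLE_mul_log_le hm
  obtain ⟨q, hq⟩ : ∃ q : ℝ, q = (oddPrimesLE (4 * m + 1)).card := ⟨_, rfl⟩
  obtain ⟨l, hl⟩ : ∃ l, l = Real.log m := ⟨_, rfl⟩
  obtain ⟨L, hL⟩ : ∃ L, L = Real.log ((y : ℝ) + 2 * m) := ⟨_, rfl⟩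
  have hS : ∑ p ∈ oddPrimesLE (4 * m + 1), (Nat.log p (y + 2 * m) : ℝ) * Real.log p ≤ q * L := by
    rw [hq, ← nsmul_eq_mul]
    refine Finset.sum_le_card_nsmul _ _ _ fun p hp => ?_
    rw [← Real.log_pow, hL]
    have hp0 := (mem_oddPrimesLE.1 hp).2.2.pos
    refine Real.log_le_log (by positivity) ?_
    exact_mod_cast Nat.pow_log_le_self p (by omega)
  have hyL : L - 0.0625 ≤ Real.log y := by
    have e1 : Real.log ((y : ℝ) + 2 * m) ≤ Real.log (y * (17 / 16)) :=
      Real.log_le_log (by positivity) (by linarith)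
    rw [Real.log_mul (by positivity) (by positivity)] at e1
    have e2 := Real.log_le_sub_one_of_pos (show (0 : ℝ) < 17 / 16 by norm_num)
    linarith
  have hLl : 2 * l + 2.7725 ≤ L := by
    have e1 : Real.log ((2 ^ 2 * m) ^ 2) ≤ Real.log ((y : ℝ) + 2 * m) :=
      Real.log_le_log (by positivity) (by nlinarith)
    rw [Real.log_pow, Real.log_mul (by positivity) (by positivity), Real.log_pow] at e1
    norm_num at e1
    linarith
  rw [← hq, ← hl] at hpi
  rw [← hl, ← hL] at h
  rw [← hl] at hlogm
  have hq0 : 0 ≤ q := hq ▸ Nat.cast_nonneg _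
  have hqm : q ≤ m := by
    have : q * l ≤ m * l := hpi.trans (mul_le_mul_of_nonneg_left (by linarith) hm0.le)
    exact le_of_mul_le_mul_right this (by linarith)
  have e1 : (m - q) * (2 * l + 2.7725) ≤ (m - q) * L :=
    mul_le_mul_of_nonneg_left hLl (by linarith)
  have e2 : q * (2 * l + 2.7725) ≤ q * (2.327 * l) :=
    mul_le_mul_of_nonneg_left (by linarith) hq0
  have e3 := mul_le_mul_of_nonneg_left hyL hm0.le
  have e4 := mul_le_mul_of_nonneg_left hlog2.le hm0.le
  have e5 := mul_le_mul_of_nonneg_left hlogm hm0.le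
  have e6 := log_le_two_pow 13 hm0
  rw [← hl] at e6
  norm_num at e6
  nlinarith

open Chebyshev in
lemma exists_prime_of_large {x : ℝ} (hx : 800000 ≤ x) :
    ∃ p : ℕ, p.Prime ∧ x < p ∧ (p : ℝ) ≤ 1.1565 * x := by
  by_contra! hno
  have hx0 : 0 < x := by linarith
  have h1 : θ (1.1565 * x) ≤ θ x := by
    rw [theta, theta]
    refine Finset.sum_le_sum_of_subset_of_nonneg (fun p hp => ?_)
      fun p _ _ => Real.log_natCast_nonneg p
    rw [Finset.mem_filter, Finset.mem_Ioc] at hp ⊢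
    refine ⟨⟨hp.1.1, Nat.le_floor ?_⟩, hp.2⟩
    by_contra! h
    have := hno p hp.2 h
    have := (Nat.le_floor_iff (by positivity)).1 hp.1.2
    linarith
  have h2 := psi_ge_linear (1.1565 * x)
  have h3 := psi_sub_theta_le_sqrt (x := 1.1565 * x) (by linarith)
  have h4 := (theta_le_psi x).trans (psi_le_add_log (by linarith))
  have h5 := log_le_two_pow 20 hx0
  have h6 : √(1.1565 * x) ≤ (1.1565 * x / 960 + 960) / 2 := by
    refine Real.sqrt_le_iff.2 ⟨by positivity, ?_⟩
    nlinarith [sq_nonneg (1.1565 * x / 960 - 960)]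
  have := Real.log_two_lt_d9
  norm_num at h5
  linarith

/-- The largest number coprime to `K` in `(q, q + g]`, or `q` if there is none. -/
def lastCoprime (K q : ℕ) : ℕ → ℕ
  | 0 => q
  | g + 1 => bif Nat.beq (Nat.gcd (q + g + 1) K) 1 then q + g + 1 else lastCoprime K q g

/-- Starting from `q`, jump repeatedly to the last number coprime to `K` within distance `gap q`;
test whether `B` is reached. -/
def coprimeChain (K B : ℕ) (gap : ℕ → ℕ) : ℕ → ℕ → Bool
  | 0, q => Nat.ble B q
  | fuel + 1, q => Nat.ble B q ||
      match lastCoprime K q (gap q) with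
      | 0 => false
      | q' + 1 => Nat.ble q q' && coprimeChain K B gap fuel (q' + 1)

lemma lastCoprime_spec (K q g : ℕ) :
    lastCoprime K q g = q ∨
      (lastCoprime K q g ≤ q + g ∧ Nat.Coprime (lastCoprime K q g) K) := by
  induction g with
  | zero => exact Or.inl rfl
  | succ g ih =>
    rw [lastCoprime]
    cases h : Nat.beq (Nat.gcd (q + g + 1) K) 1
    · rw [cond_false]
      exact ih.imp_right fun h => ⟨by omega, h.2⟩
    · rw [cond_true]
      exact Or.inr ⟨by omega, Nat.eq_of_beq_eq_true h⟩

lemma exists_coprime_of_coprimeChain {K B : ℕ} {gap : ℕ → ℕ} (hgap : Monotone gap) {fuel q x : ℕ}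
    (h : coprimeChain K B gap fuel q = true) (hqx : q ≤ x) (hx : x < B) :
    ∃ p, Nat.Coprime p K ∧ x < p ∧ p ≤ x + gap x := by
  induction fuel generalizing q with
  | zero =>
    rw [coprimeChain] at h
    have := Nat.le_of_ble_eq_true h
    omega
  | succ f ih =>
    rw [coprimeChain, Bool.or_eq_true] at h
    rcases h with h | h
    · have := Nat.le_of_ble_eq_true h
      omega
    · have hspec := lastCoprime_spec K q (gap q)
      revert h hspec
      generalize lastCoprime K q (gap q) = r
      rcases r with _ | q'
      · simp
      · intro h hspec
        simp only [Bool.and_eq_true] at h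
        have h1 := Nat.le_of_ble_eq_true h.1
        rcases lt_or_ge x (q' + 1) with h2 | h2
        · rcases hspec with h3 | h3
          · omega
          · have := hgap hqx
            exact ⟨q' + 1, h3.2, h2, by omega⟩
        · exact ih h.2 h2

lemma prime_of_coprime_factorial {b p : ℕ} (hp : Nat.Coprime p b !) (hp1 : 1 < p)
    (hpb : p < (b + 1) ^ 2) : p.Prime := by
  by_contra h
  have h1 := Nat.minFac_sq_le_self (by omega) h
  have h2 := Nat.minFac_prime (n := p) (by omega)
  have h3 : p.minFac ≤ b := by
    by_contra! h4
    have := Nat.pow_le_pow_left (show b + 1 ≤ p.minFac from h4) 2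
    omega
  have h4 := Nat.dvd_gcd (Nat.minFac_dvd p) (h2.dvd_factorial.2 h3)
  rw [hp] at h4
  exact h2.one_lt.ne' (Nat.dvd_one.1 h4)

lemma coprimeChain_factorial_640 :
    coprimeChain 640 ! 400010 (fun _ => 284) 1600 573 = true := by
  decide +kernel

lemma coprimeChain_factorial_2700 :
    coprimeChain 2700 ! 6400010 (fun q => (q - 33) / 16) 100 400009 = true := by
  decide +kernel

lemma exists_prime_gap_284 {x : ℕ} (h1 : 573 ≤ x) (h2 : x < 400010) :
    ∃ p, p.Prime ∧ x < p ∧ p ≤ x + 284 := by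
  obtain ⟨p, h3, h4, h5⟩ :=
    exists_coprime_of_coprimeChain monotone_const coprimeChain_factorial_640 h1 h2
  exact ⟨p, prime_of_coprime_factorial h3 (by omega) (by omega), h4, h5⟩

lemma exists_prime_gap_div {x : ℕ} (h1 : 400009 ≤ x) (h2 : x < 6400010) :
    ∃ p, p.Prime ∧ x < p ∧ p ≤ x + (x - 33) / 16 := by
  obtain ⟨p, h3, h4, h5⟩ := exists_coprime_of_coprimeChain
    (fun a b hab => Nat.div_le_div_right (Nat.sub_le_sub_right hab 33))
    coprimeChain_factorial_2700 h1 h2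
  exact ⟨p, prime_of_coprime_factorial h3 (by omega) (by omega), h4, h5⟩

/-- Evaluate the first argument, then apply the second one to it. -/
def forceNat (n : ℕ) (f : ℕ → Bool) : Bool :=
  match n with
  | 0 => f 0
  | k + 1 => f (k + 1)

lemma forceNat_eq (n : ℕ) (f : ℕ → Bool) : forceNat n f = f n := by
  cases n <;> rfl

/-- Running through `fuel` successive values of `m`, with `o` an odd part of `m !` and `c` a bound
for the number of odd primes up to `4 * m + 1`, test that `o * N ^ c < (N - 2 * m) ^ m`;
the numbers coprime to `K` are counted as primes. -/
def powCompareLoop (K N : ℕ) : ℕ → ℕ → ℕ → ℕ → Bool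
  | 0, _, _, _ => true
  | fuel + 1, m, o, c =>
      (Nat.ble c m && Nat.ble (o * N ^ c + 1) ((N - 2 * m) ^ m)) &&
        forceNat (m + 1) fun m' =>
          forceNat (o * (m' / Nat.gcd m' 8192)) fun o' =>
            forceNat (c + (bif Nat.beq (Nat.gcd (4 * m + 3) K) 1 then 1 else 0) +
                (bif Nat.beq (Nat.gcd (4 * m + 5) K) 1 then 1 else 0)) fun c' =>
              powCompareLoop K N fuel m' o' c'

lemma powCompareLoop_factorial_141 :
    powCompareLoop 141 ! 400000 4857 143 (143 ! / 2 ^ 138) 104 = true := by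
  decide +kernel

lemma factorial_143_eq : 143 ! = 143 ! / 2 ^ 138 * 2 ^ 138 := by
  decide +kernel

lemma card_oddPrimesLE_573 : (oddPrimesLE 573).card ≤ 104 := by
  have hsub : oddPrimesLE 573 ⊆ (Finset.Ico 2 574).filter (fun p => Nat.gcd p 23 ! = 1) ∪
      ({3, 5, 7, 11, 13, 17, 19, 23} : Finset ℕ) := by
    intro p hp
    rw [mem_oddPrimesLE] at hp
    have h2 := hp.2.2.two_le
    rw [Finset.mem_union, Finset.mem_filter, Finset.mem_Ico]
    rcases lt_or_ge 23 p with h | h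
    · exact Or.inl ⟨⟨h2, by omega⟩, hp.2.2.coprime_factorial_of_lt h⟩
    · right
      obtain ⟨hp2, -, hp⟩ := hp
      interval_cases p <;> first | decide | omega | (exfalso; revert hp; norm_num)
  refine (Finset.card_le_card hsub).trans ?_
  decide +kernel

lemma card_oddPrimesLE_add_four_le {m b : ℕ} (hb : b < 4 * m + 2) :
    (oddPrimesLE (4 * (m + 1) + 1)).card ≤ (oddPrimesLE (4 * m + 1)).card +
      (bif Nat.beq (Nat.gcd (4 * m + 3) b !) 1 then 1 else 0) +
      (bif Nat.beq (Nat.gcd (4 * m + 5) b !) 1 then 1 else 0) := by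
  have key : ∀ q, b < q → (if q.Prime then 1 else 0) ≤
      (bif Nat.beq (Nat.gcd q b !) 1 then 1 else 0) := by
    intro q hq
    split_ifs with hp
    · have : Nat.gcd q b ! = 1 := hp.coprime_factorial_of_lt hq
      simp [this]
    · exact Nat.zero_le _
  have hsub : oddPrimesLE (4 * (m + 1) + 1) ⊆ oddPrimesLE (4 * m + 1) ∪
      ({4 * m + 3} : Finset ℕ).filter Nat.Prime ∪ ({4 * m + 5} : Finset ℕ).filter Nat.Prime := by
    intro p hp
    rw [mem_oddPrimesLE] at hp
    simp only [Finset.mem_union, mem_oddPrimesLE, Finset.mem_filter, Finset.mem_singleton]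
    have h2 := Nat.odd_iff.1 (hp.2.2.odd_of_ne_two hp.1)
    have h3 : p ≤ 4 * m + 1 ∨ p = 4 * m + 3 ∨ p = 4 * m + 5 := by omega
    tauto
  have hone : ∀ q, (({q} : Finset ℕ).filter Nat.Prime).card = if q.Prime then 1 else 0 := by
    intro q
    rw [Finset.filter_singleton]
    split_ifs <;> simp
  have h1 := key (4 * m + 3) (by omega)
  have h2 := key (4 * m + 5) (by omega)
  rw [← hone] at h1 h2
  have h3 := Finset.card_le_card hsub
  have h4 := Finset.card_union_le (oddPrimesLE (4 * m + 1) ∪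
      ({4 * m + 3} : Finset ℕ).filter Nat.Prime) (({4 * m + 5} : Finset ℕ).filter Nat.Prime)
  have h5 := Finset.card_union_le (oddPrimesLE (4 * m + 1))
      (({4 * m + 3} : Finset ℕ).filter Nat.Prime)
  omega

lemma factorial_succ_eq_mul_two_pow {m o : ℕ} (h : ∃ v, m ! = o * 2 ^ v) :
    ∃ v, (m + 1) ! = o * ((m + 1) / Nat.gcd (m + 1) 8192) * 2 ^ v := by
  obtain ⟨v, hv⟩ := h
  obtain ⟨j, -, hj⟩ := (Nat.dvd_prime_pow Nat.prime_two (m := 13)).1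
    (Nat.gcd_dvd_right (m + 1) 8192)
  have h1 := Nat.div_mul_cancel (Nat.gcd_dvd_left (m + 1) 8192)
  refine ⟨v + j, ?_⟩
  calc (m + 1) ! = (m + 1) / Nat.gcd (m + 1) 8192 * Nat.gcd (m + 1) 8192 * (o * 2 ^ v) := by
        rw [h1, Nat.factorial_succ, hv]
    _ = _ := by rw [hj]; ring

lemma exists_bounds_of_powCompareLoop {b N fuel m₀ o c m : ℕ}
    (h : powCompareLoop b ! N fuel m₀ o c = true) (hb : b < 4 * m₀ + 2)
    (ho : ∃ v, m₀ ! = o * 2 ^ v) (hc : (oddPrimesLE (4 * m₀ + 1)).card ≤ c)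
    (h₀ : m₀ ≤ m) (hm : m < m₀ + fuel) :
    ∃ o c, (∃ v, m ! = o * 2 ^ v) ∧ (oddPrimesLE (4 * m + 1)).card ≤ c ∧ c ≤ m ∧
      o * N ^ c < (N - 2 * m) ^ m := by
  induction fuel generalizing m₀ o c with
  | zero => omega
  | succ f ih =>
    simp only [powCompareLoop, forceNat_eq, Bool.and_eq_true] at h
    rcases h₀.eq_or_lt with rfl | h₁
    · exact ⟨o, c, ho, hc, Nat.le_of_ble_eq_true h.1.1, Nat.le_of_ble_eq_true h.1.2⟩
    · refine ih h.2 (by omega) (factorial_succ_eq_mul_two_pow ho) ?_ h₁ (by omega)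
      have := card_oddPrimesLE_add_four_le hb
      omega

lemma not_smooth_of_small {y m : ℕ} (hm₀ : 143 ≤ m) (hm : m < 5000) (hN : 400000 ≤ y + 2 * m)
    (hy : Even y) (hs : ∀ p : ℕ, p.Prime → p ∣ stepTwoProd y m → p ≤ 4 * m + 1) : False := by
  obtain ⟨o, c, ⟨v, hv⟩, hc, hcm, hlt⟩ := exists_bounds_of_powCompareLoop
    powCompareLoop_factorial_141 (by norm_num) ⟨_, factorial_143_eq⟩ card_oddPrimesLE_573 hm₀
    (by omega : m < 143 + 4857)
  obtain ⟨N, hNdef⟩ : ∃ N, N = y + 2 * m := ⟨_, rfl⟩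
  rw [← hNdef] at hN
  have h1 := stepTwoProd_mul_le hy hs
  rw [← hNdef] at h1
  have h2 : ∏ p ∈ oddPrimesLE (4 * m + 1), p ^ Nat.log p N ≤ N ^ c := by
    refine (Finset.prod_le_pow_card _ _ N fun p _ => Nat.pow_log_le_self p (by omega)).trans ?_
    exact Nat.pow_le_pow_right (by omega) hc
  have h3 : v ≤ (m !).factorization 2 :=
    (Nat.prime_two.pow_dvd_iff_le_factorization (Nat.factorial_ne_zero m)).1
      (hv ▸ Dvd.intro_left o rfl)
  have h4 : y ^ m ≤ stepTwoProd y m := by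
    rw [stepTwoProd]
    refine le_trans (by simp) (Finset.prod_le_prod' (f := fun _ => y) fun i _ => ?_)
    omega
  have h5 : y ^ m ≤ o * N ^ c := by
    have h6 : y ^ m * 2 ^ v ≤ o * N ^ c * 2 ^ v := by
      calc y ^ m * 2 ^ v ≤ stepTwoProd y m * 2 ^ (m !).factorization 2 :=
            Nat.mul_le_mul h4 (Nat.pow_le_pow_right two_pos h3)
        _ ≤ m ! * N ^ c := h1.trans (Nat.mul_le_mul_left _ h2)
        _ = o * N ^ c * 2 ^ v := by rw [hv]; ring
    exact Nat.le_of_mul_le_mul_right h6 (by positivity)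
  have h7 : N * (400000 - 2 * m) ≤ 400000 * y := by
    zify [show 2 * m ≤ 400000 by omega]
    zify at hN hNdef
    nlinarith
  have h8 : N ^ m * (400000 - 2 * m) ^ m ≤ 400000 ^ m * y ^ m := by
    rw [← mul_pow, ← mul_pow]
    exact Nat.pow_le_pow_left h7 m
  have h9 : (400000 : ℕ) ^ (m - c) ≤ N ^ (m - c) := Nat.pow_le_pow_left hN _
  have hpow : ∀ x : ℕ, x ^ m = x ^ (m - c) * x ^ c := fun x => by
    rw [← pow_add, Nat.sub_add_cancel hcm]
  have h10 : N ^ m * (400000 - 2 * m) ^ m ≤ N ^ m * (o * 400000 ^ c) := by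
    calc N ^ m * (400000 - 2 * m) ^ m ≤ 400000 ^ m * (o * N ^ c) :=
          h8.trans (Nat.mul_le_mul_left _ h5)
      _ = 400000 ^ (m - c) * (400000 ^ c * o * N ^ c) := by
          rw [hpow 400000]; ring
      _ ≤ N ^ (m - c) * (400000 ^ c * o * N ^ c) := Nat.mul_le_mul_right _ h9
      _ = N ^ m * (o * 400000 ^ c) := by
          rw [hpow N]; ring
  have h11 := Nat.le_of_mul_le_mul_left h10 (Nat.pow_pos (by omega))
  omega

lemma not_prime_of_mem_range {y m p : ℕ} (h4 : 4 * m ≤ y) (hy : Even y)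
    (hs : ∀ p : ℕ, p.Prime → p ∣ stepTwoProd y m → p ≤ 4 * m + 1)
    (h1 : y + 1 < p) (h2 : p < y + 2 * m) : ¬ p.Prime := by
  intro hp
  have hodd : p % 2 = 1 := Nat.odd_iff.1 (hp.odd_of_ne_two (by omega))
  have hy2 := Nat.even_iff.1 hy
  have h3 : p ∣ stepTwoProd y m := by
    have h5 : p = y + 2 * ((p - y - 1) / 2) + 1 := by omega
    have h6 := Finset.dvd_prod_of_mem (fun i => y + 2 * i + 1)
      (Finset.mem_range.2 (by omega : (p - y - 1) / 2 < m))
    rw [stepTwoProd]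
    exact (dvd_of_eq h5).trans h6
  have := hs p hp h3
  omega

lemma not_smooth_of_four_mul_le {y m : ℕ} (hm : 143 ≤ m) (h4 : 4 * m ≤ y) (hy : Even y)
    (hs : ∀ p : ℕ, p.Prime → p ∣ stepTwoProd y m → p ≤ 4 * m + 1) : False := by
  have key : ∀ p, p.Prime → y + 1 < p → y + 2 * m ≤ p := fun p hp h1 => by
    by_contra! h2
    exact not_prime_of_mem_range h4 hy hs h1 h2 hp
  rcases lt_or_ge m 5000 with hm1 | hm1
  · rcases le_or_gt y 400000 with hy1 | hy1
    · obtain ⟨p, hp, h1, h2⟩ := exists_prime_gap_284 (x := y + 1) (by omega) (by omega)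
      have := key p hp h1
      omega
    · exact not_smooth_of_small hm hm1 (by omega) hy hs
  rcases le_or_gt (32 * m) y with hy1 | hy1
  · rcases le_or_gt (y + 2 * m) ((4 * m + 1) ^ 2) with h | h
    · exact not_smooth_of_high hm1 hy1 h hy hs
    · exact not_smooth_of_huge hm1 h hy hs
  rcases lt_or_ge m 200000 with hm2 | hm2
  · rcases lt_or_ge (y + 1) 400010 with hy2 | hy2
    · obtain ⟨p, hp, h1, h2⟩ := exists_prime_gap_284 (x := y + 1) (by omega) hy2
      have := key p hp h1
      omega
    · obtain ⟨p, hp, h1, h2⟩ := exists_prime_gap_div (x := y + 1) (by omega) (by omega)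
      have := key p hp h1
      omega
  rcases lt_or_ge (100 * y) (1276 * m) with hy2 | hy2
  · obtain ⟨p, hp, h1, h2⟩ := exists_prime_of_large (x := ((y + 1 : ℕ) : ℝ)) (by
      have : 800000 ≤ y + 1 := by omega
      exact_mod_cast this)
    have h3 := key p hp (by exact_mod_cast h1)
    have h5 : ((y + 2 * m : ℕ) : ℝ) ≤ p := by exact_mod_cast h3
    have h6 : ((100 * y : ℕ) : ℝ) < ((1276 * m : ℕ) : ℝ) := by exact_mod_cast hy2
    have h7 : (200000 : ℝ) ≤ m := by exact_mod_cast hm2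
    push_cast at h2 h5 h6
    linarith
  · exact not_smooth_of_mid hm2 hy2 hy1.le hy hs

/-- If the half-integer binomial coefficient
`C(n − 1/2, m) = (2n−1)!! / ((2(n−m)−1)!! ⬝ 2^m ⬝ m!)` (with `1 ≤ m ≤ n`) is
`(4m + 1)`-smooth, i.e. its `p`-adic valuation is `≤ 0` for every prime `p > 4m + 1`,
then `m ≤ 142` or `n ≤ 3m − 1`. -/
theorem stmt_13 (n m : ℕ) (hmn : m ≤ n) (hm : 1 ≤ m)
    (hsmooth : ∀ p : ℕ, p.Prime → 4 * m + 1 < p →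
      padicValRat p (((2 * n - 1)‼ : ℚ) / (((2 * (n - m) - 1)‼ : ℚ) * 2 ^ m * (m ! : ℚ))) ≤ 0) :
    m ≤ 142 ∨ n ≤ 3 * m - 1 := by
  by_contra! h
  obtain ⟨k, rfl⟩ : ∃ k, n = k + m := ⟨n - m, by omega⟩
  rw [Nat.add_sub_cancel] at hsmooth
  exact not_smooth_of_four_mul_le (y := 2 * k) (by omega) (by omega) (even_two_mul k)
    fun p hp hpd => prime_dvd_stepTwoProd_le hsmooth hp hpd
end

section
/- Let r and s be positive integers with s ≥ 2. If the rational number p_{s,2} = (binom(s,2)/4) · (r+1)² (r+2) / (r + 1/2) is an integer, then r < (3/4)·s². -/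
/-- For positive integers `r, s` with `s ≥ 2`, if
`p_{s,2} = (C(s,2)/4) ⬝ (r+1)² (r+2) / (r + 1/2)` is an integer, then `r < (3/4) s²`. -/
theorem stmt_14 (r s : ℕ) (hr : 0 < r) (hs : 2 ≤ s)
    (hint : ∃ k : ℤ,
      ((s.choose 2 : ℚ) / 4) * ((r : ℚ) + 1) ^ 2 * ((r : ℚ) + 2) / ((r : ℚ) + 1 / 2) = k) :
    (r : ℚ) < 3 / 4 * (s : ℚ) ^ 2 := by
  obtain ⟨k, hk⟩ := hint
  have hq : (s.choose 2 : ℚ) * (r + 1) ^ 2 * (r + 2) = 2 * (2 * r + 1) * k := by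
    rw [div_eq_iff (by positivity)] at hk
    linear_combination 4 * hk
  have hz : (s.choose 2 : ℤ) * (r + 1) ^ 2 * (r + 2) = 2 * (2 * r + 1) * k := by
    exact_mod_cast hq
  -- Modulo `2r + 1`, we have `2(r + 1) ≡ 1` and `2(r + 2) ≡ 3`.
  have hdvd : (2 * r + 1 : ℤ) ∣ 3 * s.choose 2 :=
    ⟨16 * k - s.choose 2 * ((2 * r + 1) ^ 2 + 5 * (2 * r + 1) + 7), by
      linear_combination 8 * hz⟩
  have hpos : 0 < s.choose 2 := Nat.choose_pos hs
  have hle : (2 * r + 1 : ℤ) ≤ 3 * s.choose 2 := Int.le_of_dvd (by positivity) hdvd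
  have hleq : (2 * r + 1 : ℚ) ≤ 3 * s.choose 2 := by exact_mod_cast hle
  rw [Nat.cast_choose_two] at hleq
  have hs0 : (0 : ℚ) ≤ s := by positivity
  linarith
end

section
/- Let r, s be positive integers with s ≥ 2 and set k = ⌊s/2⌋. If the rational number p_{s,s} = (r+s−1)^{\underline{⌊s/2⌋}} · (r+1)^{\overline{s}} / (2^s · (r+1/2)^{\overline{⌊s/2⌋}}) is an integer, then the rational number binom(r+k−1/2, k) = ((r+1/2)(r+3/2)⋯(r+k−1/2)) / k! is (2s−1)-smooth, i.e., val_p(binom(r+k−1/2, k)) ≤ 0 for every prime p > 2s−1. -/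
/-- Evaluating the rising factorial at `r + 1 / 2` gives a product of odd numbers over a power of
two. -/
theorem ascPochhammer_eval_add_half (r k : ℕ) :
    (ascPochhammer ℚ k).eval ((r : ℚ) + 1 / 2) =
      ((∏ j ∈ Finset.range k, (2 * r + 2 * j + 1) : ℕ) : ℚ) / ((2 ^ k : ℕ) : ℚ) := by
  induction k with
  | zero => simp
  | succ k ih =>
    rw [ascPochhammer_succ_eval, ih, Finset.prod_range_succ]
    push_cast
    field_simp
    ring

theorem descPochhammer_eval_add_sub_one (r s k : ℕ) (hk : k < s) :
    (descPochhammer ℚ k).eval ((r : ℚ) + s - 1) =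
      ((∏ j ∈ Finset.range k, (r + (s - 1 - j)) : ℕ) : ℚ) := by
  rw [descPochhammer_eval_eq_prod_range]
  push_cast
  refine Finset.prod_congr rfl fun j hj => ?_
  have hj' := Finset.mem_range.mp hj
  rw [Nat.cast_sub (by omega), Nat.cast_sub (by omega)]
  push_cast
  ring

theorem ascPochhammer_eval_add_one (r s : ℕ) :
    (ascPochhammer ℚ s).eval ((r : ℚ) + 1) =
      ((∏ j ∈ Finset.range s, (r + (j + 1)) : ℕ) : ℚ) := by
  induction s with
  | zero => simp
  | succ s ih =>
    rw [ascPochhammer_succ_eval, ih, Finset.prod_range_succ]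
    push_cast
    ring

/-- A number larger than `2 * s - 1` cannot divide both `2 * r + 2 * j + 1` and `r + i` when
`j < s` and `1 ≤ i ≤ s`. -/
theorem not_dvd_add_of_dvd_two_mul_add_one {p r s i j : ℕ} (hp : 2 * s - 1 < p) (hj : j < s)
    (hi : 1 ≤ i) (his : i ≤ s) (h : p ∣ 2 * r + 2 * j + 1) : ¬ p ∣ r + i := by
  intro h'
  have hd : (p : ℤ) ∣ 2 * ((i : ℤ) - j) - 1 := by
    have h1 : (p : ℤ) ∣ 2 * r + 2 * j + 1 := by exact_mod_cast h
    have h2 : (p : ℤ) ∣ r + i := by exact_mod_cast h'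
    have h3 := dvd_sub (h2.mul_left 2) h1
    rwa [show (2 : ℤ) * (r + i) - (2 * r + 2 * j + 1) = 2 * ((i : ℤ) - j) - 1 by ring] at h3
  have := Int.eq_zero_of_abs_lt_dvd hd (by rw [abs_lt]; constructor <;> omega)
  omega

/-- For positive integers `r, s` with `s ≥ 2` and `k = ⌊s/2⌋`, if
`p_{s,s} = (r+s−1)^{↓⌊s/2⌋} ⬝ (r+1)^{↑s} / (2^s (r+1/2)^{↑⌊s/2⌋})` is an integer, then the
half-integer binomial coefficient `C(r+k−1/2, k) = (r+1/2)(r+3/2)⋯(r+k−1/2) / k!` is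
`(2s − 1)`-smooth: its `p`-adic valuation is `≤ 0` for every prime `p > 2s − 1`. -/
theorem stmt_15 (r s : ℕ) (hr : 0 < r) (hs : 2 ≤ s)
    (hint : ∃ N : ℤ,
      (descPochhammer ℚ (s / 2)).eval ((r : ℚ) + s - 1) *
          (ascPochhammer ℚ s).eval ((r : ℚ) + 1) /
        (2 ^ s * (ascPochhammer ℚ (s / 2)).eval ((r : ℚ) + 1 / 2)) = N) :
    ∀ p : ℕ, p.Prime → 2 * s - 1 < p →
      padicValRat p
        ((ascPochhammer ℚ (s / 2)).eval ((r : ℚ) + 1 / 2) / ((s / 2).factorial : ℚ)) ≤ 0 := by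
  obtain ⟨N, hN⟩ := hint
  intro p hp hps
  have := Fact.mk hp
  rw [descPochhammer_eval_add_sub_one r s (s / 2) (by omega), ascPochhammer_eval_add_one,
    ascPochhammer_eval_add_half] at hN
  rw [ascPochhammer_eval_add_half]
  set D := ∏ j ∈ Finset.range (s / 2), (2 * r + 2 * j + 1) with hD
  have hD0 : D ≠ 0 := Finset.prod_ne_zero_iff.mpr fun j _ => by omega
  have hDp : ¬ p ∣ D := by
    intro h
    obtain ⟨j, hj, hjp⟩ := (hp.prime.dvd_finsetProd_iff _).mp h
    rw [Finset.mem_range] at hj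
    have hno : ∀ i, 1 ≤ i → i ≤ s → ¬ p ∣ r + i := fun i hi his =>
      not_dvd_add_of_dvd_two_mul_add_one hps (by omega) hi his hjp
    have hDQ : (D : ℚ) ≠ 0 := by exact_mod_cast hD0
    have heq : ((∏ j ∈ Finset.range (s / 2), (r + (s - 1 - j)) : ℕ) : ℤ) *
        ((∏ j ∈ Finset.range s, (r + (j + 1)) : ℕ) : ℤ) * ((2 ^ (s / 2) : ℕ) : ℤ) =
        D * (N * 2 ^ s) := by
      have h2 : ((2 ^ (s / 2) : ℕ) : ℚ) ≠ 0 := by positivity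
      rw [div_eq_iff (by positivity), ← mul_div_assoc, ← mul_div_assoc, eq_div_iff h2] at hN
      have hZ := hN.trans (by ring : _ = (D : ℚ) * (N * 2 ^ s))
      exact_mod_cast hZ
    have hdvd : (p : ℤ) ∣ D * (N * 2 ^ s) := (Int.natCast_dvd_natCast.mpr h).mul_right _
    rw [← heq] at hdvd
    norm_cast at hdvd
    rcases hp.dvd_mul.mp hdvd with hdvd | hdvd
    · rcases hp.dvd_mul.mp hdvd with hdvd | hdvd
      · obtain ⟨i, hi, hip⟩ := (hp.prime.dvd_finsetProd_iff _).mp hdvd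
        rw [Finset.mem_range] at hi
        exact hno _ (by omega) (by omega) hip
      · obtain ⟨i, hi, hip⟩ := (hp.prime.dvd_finsetProd_iff _).mp hdvd
        rw [Finset.mem_range] at hi
        exact hno _ (by omega) (by omega) hip
    · have := Nat.le_of_dvd two_pos (hp.dvd_of_dvd_pow hdvd)
      omega
  rw [div_div, ← Nat.cast_mul, padicValRat.div (by exact_mod_cast hD0)
    (by exact_mod_cast mul_ne_zero (by positivity) (Nat.factorial_ne_zero _)),
    padicValRat.of_nat, padicValRat.of_nat, padicValNat.eq_zero_of_not_dvd hDp]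
  omega
end

section
/- Let r, s be integers with 2 ≤ r ≤ s − 1. If the rational number p_{s,s} = (r+s−1)^{\underline{⌊s/2⌋}} · (r+1)^{\overline{s}} / (2^s · (r+1/2)^{\overline{⌊s/2⌋}}) is an integer, then no integer q with r+s+1 ≤ q ≤ 2r+s−1 is prime. -/
open Polynomial

/-- Clearing denominators in the rising factorial of a half-integer gives a product of odd
numbers. -/
theorem two_pow_mul_ascPochhammer_eval_add_half (r h : ℕ) :
    (2 : ℚ) ^ h * (ascPochhammer ℚ h).eval ((r : ℚ) + 1 / 2) =
      ((∏ i ∈ Finset.range h, (2 * r + 1 + 2 * i) : ℕ) : ℚ) := by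
  induction h with
  | zero => simp
  | succ k ih =>
    rw [ascPochhammer_succ_eval, Finset.prod_range_succ, Nat.cast_mul, ← ih]
    push_cast
    ring

theorem Nat.Prime.not_dvd_ascFactorial {q : ℕ} (hq : q.Prime) {n k : ℕ} (h : n + k < q) :
    ¬ q ∣ (n + 1).ascFactorial k := fun hd =>
  h.not_ge (hq.dvd_factorial.1 (Nat.factorial_mul_ascFactorial n k ▸ hd.mul_left _))

theorem Nat.Prime.not_dvd_descFactorial {q : ℕ} (hq : q.Prime) {n k : ℕ} (hk : k ≤ n)
    (h : n < q) : ¬ q ∣ n.descFactorial k := fun hd =>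
  h.not_ge (hq.dvd_factorial.1 (Nat.factorial_mul_descFactorial hk ▸ hd.mul_left _))

/-- For integers `2 ≤ r ≤ s − 1`, if
`p_{s,s} = (r+s−1)^{↓⌊s/2⌋} ⬝ (r+1)^{↑s} / (2^s (r+1/2)^{↑⌊s/2⌋})` is an integer, then no
integer `q` with `r + s + 1 ≤ q ≤ 2r + s − 1` is prime. -/
theorem stmt_16 (r s : ℕ) (hr : 2 ≤ r) (hrs : r ≤ s - 1)
    (hint : ∃ N : ℤ,
      (descPochhammer ℚ (s / 2)).eval ((r : ℚ) + s - 1) *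
          (ascPochhammer ℚ s).eval ((r : ℚ) + 1) /
        (2 ^ s * (ascPochhammer ℚ (s / 2)).eval ((r : ℚ) + 1 / 2)) = N) :
    ∀ q : ℕ, r + s + 1 ≤ q → q ≤ 2 * r + s - 1 → ¬ q.Prime := by
  intro q hq1 hq2 hq
  obtain ⟨N, hN⟩ := hint
  have hodd : q % 2 = 1 := Nat.odd_iff.1 (hq.odd_of_ne_two (by omega))
  have hdesc : (descPochhammer ℚ (s / 2)).eval ((r : ℚ) + s - 1) =
      ((r + s - 1).descFactorial (s / 2) : ℚ) := by
    rw [← descPochhammer_eval_eq_descFactorial, Nat.cast_sub (by omega)]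
    push_cast
    rfl
  have hasc : (ascPochhammer ℚ s).eval ((r : ℚ) + 1) = ((r + 1).ascFactorial s : ℚ) := by
    rw [Nat.cast_ascFactorial]
    push_cast
    rfl
  have hpow : (2 : ℚ) ^ s = 2 ^ (s - s / 2) * 2 ^ (s / 2) := by
    rw [← pow_add, Nat.sub_add_cancel (Nat.div_le_self s 2)]
  have hprod_ne : (∏ i ∈ Finset.range (s / 2), (2 * r + 1 + 2 * i) : ℕ) ≠ 0 :=
    Finset.prod_ne_zero_iff.2 fun i _ => by omega
  rw [hdesc, hasc, hpow, mul_assoc, two_pow_mul_ascPochhammer_eval_add_half,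
    div_eq_iff (mul_ne_zero (by positivity) (Nat.cast_ne_zero.2 hprod_ne))] at hN
  have hdvd : q ∣ ∏ i ∈ Finset.range (s / 2), (2 * r + 1 + 2 * i) := by
    have hmem : (q - (2 * r + 1)) / 2 ∈ Finset.range (s / 2) := Finset.mem_range.2 (by omega)
    have hfac := Finset.dvd_prod_of_mem (fun i => 2 * r + 1 + 2 * i) hmem
    rwa [show 2 * r + 1 + 2 * ((q - (2 * r + 1)) / 2) = q by omega] at hfac
  have hZ : (((r + s - 1).descFactorial (s / 2) * (r + 1).ascFactorial s : ℕ) : ℤ) =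
      N * (2 ^ (s - s / 2) * ((∏ i ∈ Finset.range (s / 2), (2 * r + 1 + 2 * i) : ℕ) : ℤ)) := by
    exact_mod_cast hN
  have hnum : q ∣ (r + s - 1).descFactorial (s / 2) * (r + 1).ascFactorial s := by
    rw [← Int.natCast_dvd_natCast, hZ]
    exact ((Int.natCast_dvd_natCast.2 hdvd).mul_left _).mul_left _
  rcases hq.dvd_mul.1 hnum with hd | hd
  · exact hq.not_dvd_descFactorial (by omega) (by omega) hd
  · exact hq.not_dvd_ascFactorial (by omega) hd
end

section
/- Let n ≥ 2 be an integer and let C = {x ⊆ {1,…,2n} : |x| = n and 1 ∈ x}. Then the distance set of C is S(C) = {1, 2, …, n−1}; in particular C is a Johnson code with symmetric distances of degree s = n − 1, and |C| = binom(2n−1, n−1) = binom(2n−1, s), so C attains the upper bound |C| ≤ binom(2n−1, s). -/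
open Finset

/-- The set of Johnson distances between distinct codewords of `C`. -/
def johnsonDistSet (n : ℕ) (C : Finset (Finset (Fin (2 * n)))) : Finset ℕ :=
  ((C ×ˢ C).filter fun p => p.1 ≠ p.2).image fun p => n - (p.1 ∩ p.2).card

section PointedSubsets

variable {α : Type*} [Fintype α] [DecidableEq α]

/-- The number of subsets of size `k + 1` containing a given point. -/
theorem card_filter_card_eq_and_mem (a : α) (k : ℕ) :
    (univ.filter fun x : Finset α => x.card = k + 1 ∧ a ∈ x).card =
      (Fintype.card α - 1).choose k := by
  have h : (univ.filter fun x : Finset α => x.card = k + 1 ∧ a ∈ x) =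
      ((univ.erase a).powersetCard k).image (insert a) := by
    ext x
    simp only [mem_filter, mem_univ, true_and, mem_image, mem_powersetCard]
    constructor
    · rintro ⟨hx, ha⟩
      exact ⟨x.erase a, ⟨erase_subset_erase _ (subset_univ _),
        by rw [card_erase_of_mem ha, hx, Nat.add_sub_cancel]⟩, insert_erase ha⟩
    · rintro ⟨y, ⟨hy, hk⟩, rfl⟩
      have ha : a ∉ y := fun h => notMem_erase a univ (hy h)
      exact ⟨by rw [card_insert_of_notMem ha, hk], mem_insert_self _ _⟩
  rw [h, card_image_of_injOn, card_powersetCard, card_erase_of_mem (mem_univ a), card_univ]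
  intro y hy z hz hyz
  have notMem : ∀ w ∈ (univ.erase a).powersetCard k, a ∉ w := fun w hw h =>
    notMem_erase a univ ((mem_powersetCard.1 hw).1 h)
  have h := congrArg (fun w => w.erase a) hyz
  simpa [erase_insert (notMem y hy), erase_insert (notMem z hz)] using h

/-- Two subsets of size `n` containing a given point can have any prescribed intersection size
`n - k` with `k < n`, provided there is enough room. -/
theorem exists_card_eq_mem_card_inter_eq (a : α) {n k : ℕ} (hk : k < n)
    (hn : 2 * n ≤ Fintype.card α) :
    ∃ x y : Finset α, (x.card = n ∧ a ∈ x) ∧ (y.card = n ∧ a ∈ y) ∧ (x ∩ y).card = n - k := by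
  obtain ⟨x, hax, -, hx⟩ := exists_subsuperset_card_eq (subset_univ {a})
    (show ({a} : Finset α).card ≤ n by rw [card_singleton]; omega)
    (show n ≤ (univ : Finset α).card by rw [card_univ]; omega)
  rw [singleton_subset_iff] at hax
  obtain ⟨t, hat, htx, ht⟩ := exists_subsuperset_card_eq (singleton_subset_iff.2 hax)
    (show ({a} : Finset α).card ≤ n - k by rw [card_singleton]; omega)
    (show n - k ≤ x.card by omega)
  obtain ⟨u, hu, huk⟩ := exists_subset_card_eq
    (show k ≤ xᶜ.card by rw [card_compl]; omega)
  have hxu : Disjoint x u := disjoint_compl_right.mono_right hu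
  refine ⟨x, t ∪ u, ⟨hx, hax⟩, ⟨?_, mem_union_left _ (singleton_subset_iff.1 hat)⟩, ?_⟩
  · rw [card_union_of_disjoint (hxu.mono_left htx)]
    omega
  · rw [inter_union_distrib_left, disjoint_iff_inter_eq_empty.1 hxu, union_empty,
      inter_eq_right.2 htx, ht]

end PointedSubsets

/-- For `n ≥ 2`, the family `C` of all `n`-subsets of `{1, …, 2n}`
containing a fixed point has distance set `{1, …, n − 1}`; in particular it is a Johnson
code with symmetric distances of degree `s = n − 1`, and `|C| = C(2n − 1, n − 1)`, i.e.
`C` attains the bound `|C| ≤ C(2n − 1, s)`. -/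
theorem stmt_18 (n : ℕ) (hn : 2 ≤ n)
    (C : Finset (Finset (Fin (2 * n))))
    (hC : C = Finset.univ.filter fun x => x.card = n ∧ (⟨0, by omega⟩ : Fin (2 * n)) ∈ x) :
    johnsonDistSet n C = Finset.Icc 1 (n - 1) ∧
      (∀ a ∈ johnsonDistSet n C, n - a ∈ johnsonDistSet n C) ∧
      (johnsonDistSet n C).card = n - 1 ∧
      C.card = (2 * n - 1).choose (n - 1) ∧
      C.card = (2 * n - 1).choose (johnsonDistSet n C).card := by
  have hS : johnsonDistSet n C = Finset.Icc 1 (n - 1) := by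
    subst hC
    ext k
    simp only [johnsonDistSet, mem_image, mem_filter, mem_product, mem_univ, true_and,
      Prod.exists, mem_Icc]
    constructor
    · rintro ⟨x, y, ⟨⟨⟨hx, hax⟩, hy, hay⟩, hxy⟩, rfl⟩
      have hpos : 0 < (x ∩ y).card := card_pos.2 ⟨_, mem_inter.2 ⟨hax, hay⟩⟩
      have hlt : (x ∩ y).card < n := by
        by_contra! h
        have h1 : x ∩ y = x := eq_of_subset_of_card_le inter_subset_left (by omega)
        have h2 : x ∩ y = y := eq_of_subset_of_card_le inter_subset_right (by omega)
        exact hxy (h1.symm.trans h2)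
      omega
    · rintro ⟨h1, h2⟩
      obtain ⟨x, y, hx, hy, hxy⟩ := exists_card_eq_mem_card_inter_eq
        (⟨0, by omega⟩ : Fin (2 * n)) (show k < n by omega) (by rw [Fintype.card_fin])
      refine ⟨x, y, ⟨⟨hx, hy⟩, ?_⟩, by omega⟩
      rintro rfl
      rw [inter_self] at hxy
      omega
  have hcard : C.card = (2 * n - 1).choose (n - 1) := by
    have h := card_filter_card_eq_and_mem (⟨0, by omega⟩ : Fin (2 * n)) (n - 1)
    rwa [Nat.sub_add_cancel (by omega : 1 ≤ n), ← hC, Fintype.card_fin] at h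
  have hs : (johnsonDistSet n C).card = n - 1 := by
    rw [hS, Nat.card_Icc, Nat.add_sub_cancel]
  refine ⟨hS, fun a ha => ?_, hs, hcard, by rw [hs, hcard]⟩
  rw [hS, mem_Icc] at ha ⊢
  omega
end
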